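/- arXiv:2003.11165 — 3 statements merged into one kernel-verified Lean document; each statement's English description precedes it below -/
import Mathlib

section
/- Let φ : Γ⁺ → A₅ be the surjective homomorphism with φ(a) = (2 3)(4 5), φ(b) = (1 2)(3 5), φ(c) = (1 2 3 4 5), and let K = ker φ. Then the abelianization of K is isomorphic to (ℤ/5ℤ)³. -/
/-- The three generators `a`, `b`, `c` of the tetrahedral group `Γ⁺`. -/
inductive Gen : Type
  | a | b | c

open FreeGroup in
/-- The relations `a² = b² = c⁵ = (bc)² = (ca)³ = (ab)⁵ = 1` of `Γ⁺`. -/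
def rels : Set (FreeGroup Gen) :=
  {of Gen.a ^ 2, of Gen.b ^ 2, of Gen.c ^ 5,
    (of Gen.b * of Gen.c) ^ 2, (of Gen.c * of Gen.a) ^ 3, (of Gen.a * of Gen.b) ^ 5}

/-- `Γ⁺ = ⟨a, b, c | a² = b² = c⁵ = (bc)² = (ca)³ = (ab)⁵ = 1⟩`. -/
abbrev GammaPlus := PresentedGroup rels


set_option linter.unusedSimpArgs false

namespace SW

/-- Face permutation induced by `a`. -/
def pa : Fin 12 → Fin 12 := ![1, 0, 5, 6, 7, 2, 3, 4, 10, 11, 8, 9]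
/-- Face permutation induced by `c`. -/
def pc : Fin 12 → Fin 12 := ![0, 2, 3, 4, 5, 1, 7, 8, 9, 10, 6, 11]
/-- Face permutation induced by the image of `b`. -/
def pb : Fin 12 → Fin 12 := ![11, 10, 9, 8, 7, 6, 5, 4, 3, 2, 1, 0]
/-- Opposite face. -/
def op : Fin 12 → Fin 12 := ![11, 9, 10, 6, 7, 8, 3, 4, 5, 1, 2, 0]
/-- Exponents for `a`. -/
def ka : Fin 12 → ℕ := ![0, 0, 4, 0, 1, 1, 0, 4, 4, 0, 1, 0]
/-- Exponents for `c`. -/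
def kc : Fin 12 → ℕ := ![1, 0, 0, 0, 0, 0, 0, 0, 0, 0, 0, 4]

/-- Representatives of the cosets of `⟨c⟩` in `⟨a, c⟩`. -/
def r {G : Type*} [Group G] (a c : G) : Fin 12 → G :=
  ![1, a, c * a, c ^ 2 * a, c ^ 3 * a, c ^ 4 * a,
    a * c ^ 2 * a, c * a * c ^ 2 * a, c ^ 2 * a * c ^ 2 * a, c ^ 3 * a * c ^ 2 * a,
    c ^ 4 * a * c ^ 2 * a, a * c ^ 3 * a * c ^ 2 * a]

theorem orbit_ind (P : Fin 12 → Prop) (h0 : P 0) (ha : ∀ i, P i → P (pa i))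
    (hc : ∀ i, P i → P (pc i)) : ∀ i, P i := by
  have h1 : P 1 := ha 0 h0
  have h2 : P 2 := hc 1 h1
  have h3 : P 3 := hc 2 h2
  have h4 : P 4 := hc 3 h3
  have h5 : P 5 := hc 4 h4
  have h6 : P 6 := ha 3 h3
  have h7 : P 7 := hc 6 h6
  have h8 : P 8 := hc 7 h7
  have h9 : P 9 := hc 8 h8
  have h10 : P 10 := hc 9 h9
  have h11 : P 11 := ha 9 h9
  intro i
  fin_cases i <;> assumption

section grp
variable {G : Type*} [Group G] {a b c : G}

theorem aca (ha : a ^ 2 = 1) (hc : c ^ 5 = 1) (hca : (c * a) ^ 3 = 1) :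
    a * c * a = c ^ 4 * a * c ^ 4 := by
  have h1 : c ^ 4 = c⁻¹ := by
    rw [eq_inv_iff_mul_eq_one, ← pow_succ, hc]
  have h2 : a⁻¹ = a := by
    rw [inv_eq_iff_mul_eq_one, ← sq, ha]
  rw [h1]
  have h3 : c * a * (c * a) * (c * a) = 1 := by
    rw [← hca]; simp only [pow_succ, pow_zero, one_mul, mul_assoc]
  calc a * c * a = c⁻¹ * (c * a * (c * a) * (c * a)) * a⁻¹ * c⁻¹ := by group
    _ = c⁻¹ * a * c⁻¹ := by rw [h3, h2]; group

/-- The rewriting rules, in right associated form. -/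
structure Rules (a c : G) : Prop where
  aa : a * a = 1
  aa' : ∀ t, a * (a * t) = t
  cc : c * (c * (c * (c * c))) = 1
  cc' : ∀ t, c * (c * (c * (c * (c * t)))) = t
  k1 : a * (c * a) = c * (c * (c * (c * (a * (c * (c * (c * c)))))))
  k1' : ∀ t, a * (c * (a * t)) = c * (c * (c * (c * (a * (c * (c * (c * (c * t))))))))
  k4 : a * (c * (c * (c * (c * a)))) = c * (a * c)
  k4' : ∀ t, a * (c * (c * (c * (c * (a * t))))) = c * (a * (c * t))
  k3 : a * (c * (c * (c * a))) = c * (a * (c * (c * (a * c))))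
  k3' : ∀ t, a * (c * (c * (c * (a * t)))) = c * (a * (c * (c * (a * (c * t)))))

theorem mkRules (ha : a ^ 2 = 1) (hc : c ^ 5 = 1) (hca : (c * a) ^ 3 = 1) : Rules a c := by
  have aa : a * a = 1 := by rw [← sq, ha]
  have aa' : ∀ t, a * (a * t) = t := fun t => by rw [← mul_assoc, aa, one_mul]
  have cc : c * (c * (c * (c * c))) = 1 := by rw [← hc]; simp only [pow_succ, pow_zero, one_mul, mul_assoc]
  have cc' : ∀ t, c * (c * (c * (c * (c * t)))) = t := fun t => by
    calc _ = (c * (c * (c * (c * c)))) * t := by simp only [mul_assoc]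
      _ = t := by rw [cc, one_mul]
  have k1 : a * (c * a) = c * (c * (c * (c * (a * (c * (c * (c * c))))))) := by
    have := aca ha hc hca
    simpa only [pow_succ, pow_zero, one_mul, mul_assoc] using this
  have k1' : ∀ t, a * (c * (a * t)) =
      c * (c * (c * (c * (a * (c * (c * (c * (c * t)))))))) := fun t => by
    have := congrArg (· * t) k1
    simpa only [mul_assoc] using this
  have k4 : a * (c * (c * (c * (c * a)))) = c * (a * c) := by
    have h4 : a * (c * a) * (c * (a * c)) = 1 := by
      rw [k1]; simp only [mul_assoc, cc', aa', cc, aa, one_mul, mul_one]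
    have h5 : a * (c * a) * (a * (c * (c * (c * (c * a))))) = 1 := by
      simp only [mul_assoc, cc', aa', cc, aa, one_mul, mul_one]
    exact mul_left_cancel (h5.trans h4.symm)
  have k4' : ∀ t, a * (c * (c * (c * (c * (a * t))))) = c * (a * (c * t)) := fun t => by
    have := congrArg (· * t) k4
    simpa only [mul_assoc] using this
  have k3 : a * (c * (c * (c * a))) = c * (a * (c * (c * (a * c)))) := by
    have h : a * (c * (c * a)) = (a * (c * a)) * (a * (c * a)) := by
      simp only [mul_assoc, aa']
    have h' : c * (a * (c * (c * (a * c)))) = c * (a * (c * (c * a))) * c := by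
      simp only [mul_assoc]
    rw [h', h, k1]
    simp only [mul_assoc, cc', aa', cc, mul_one]
  have k3' : ∀ t, a * (c * (c * (c * (a * t)))) = c * (a * (c * (c * (a * (c * t))))) :=
    fun t => by
    have := congrArg (· * t) k3
    simpa only [mul_assoc] using this
  exact ⟨aa, aa', cc, cc', k1, k1', k4, k4', k3, k3'⟩

theorem c_mul_X (R : Rules a c) : c * r a c 11 = r a c 11 * c ^ 4 := by
  have h : r a c 11 = c * r a c 11 * c := by
    have e : r a c 11 = a * (c * (c * (c * (a * (c * (c * a)))))) := by
      simp [r, pow_succ, mul_assoc]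
    rw [e]
    conv_lhs => rw [R.k3', R.k3]
    simp only [mul_assoc]
  have c5 : c * c ^ 4 = 1 := by rw [← R.cc]; simp only [pow_succ, pow_zero, one_mul, mul_assoc]
  conv_rhs => rw [h]
  rw [mul_assoc, c5, mul_one]

theorem c_mul_r (R : Rules a c) (i : Fin 12) : c * r a c i = r a c (pc i) * c ^ kc i := by
  by_cases hi : i = 11
  · subst hi
    exact c_mul_X R
  obtain ⟨aa, aa', cc, cc', k1, k1', k4, k4', k3, k3'⟩ := R
  fin_cases i <;>
  first
  | exact absurd rfl hi
  | simp [r, pc, kc, pow_succ, mul_assoc, cc']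

theorem a_mul_r (R : Rules a c) (i : Fin 12) : a * r a c i = r a c (pa i) * c ^ ka i := by
  have key : a * r a c 10 = r a c 8 * c := by
    obtain ⟨aa, aa', cc, cc', k1, k1', k4, k4', k3, k3'⟩ := R
    simp [r, pow_succ, mul_assoc, k4', k3]
  have c5 : c * c ^ 4 = 1 := by rw [← R.cc]; simp only [pow_succ, pow_zero, one_mul, mul_assoc]
  have key2 : a * r a c 8 = r a c 10 * c ^ 4 := by
    calc a * r a c 8 = a * (r a c 8 * c) * c ^ 4 := by
          rw [mul_assoc, mul_assoc, c5, mul_one]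
      _ = r a c 10 * c ^ 4 := by rw [← key, R.aa']
  by_cases hi : i = 8
  · subst hi
    exact key2
  obtain ⟨aa, aa', cc, cc', k1, k1', k4, k4', k3, k3'⟩ := R
  fin_cases i <;>
  first
  | exact absurd rfl hi
  | (simp [r, pa, ka, pow_succ, mul_assoc, aa']; done)
  | simp [r, pa, ka, pow_succ, mul_assoc, aa, aa', cc', k1, k1', k4, k4', k3]

/-- The element of `⟨a, c⟩` with the same image as `b`. -/
def b0 (a c : G) : G := r a c 11 * c ^ 2

/-- The face pairing commuting with `c`. -/
def x (a b c : G) : G := b * b0 a c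

/-- The twelve face pairings. -/
def y (a b c : G) (i : Fin 12) : G := r a c i * x a b c * (r a c i)⁻¹

theorem X_sq (R : Rules a c) : r a c 11 * r a c 11 = 1 := by
  simp [r, pow_succ, mul_assoc, R.aa, R.aa', R.cc']

theorem c_pow_five (R : Rules a c) : c ^ 5 = 1 := by
  rw [← R.cc]; simp only [pow_succ, pow_zero, one_mul, mul_assoc]

theorem c_inv (R : Rules a c) : c⁻¹ = c ^ 4 := by
  rw [inv_eq_iff_mul_eq_one, ← pow_succ', c_pow_five R]

theorem a_inv (R : Rules a c) : a⁻¹ = a := by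
  rw [inv_eq_iff_mul_eq_one, R.aa]

theorem semi_X (R : Rules a c) : SemiconjBy (r a c 11) c c⁻¹ := by
  have h : SemiconjBy (r a c 11) c⁻¹ c := by
    unfold SemiconjBy
    rw [c_mul_X R, c_inv R]
  simpa using h.inv_right

theorem semi_b0 (R : Rules a c) : SemiconjBy (b0 a c) c c⁻¹ :=
  (semi_X R).mul_left ((Commute.refl c).pow_left 2)

theorem b0_sq (R : Rules a c) : b0 a c * b0 a c = 1 := by
  have h : r a c 11 * c ^ 2 = c⁻¹ ^ 2 * r a c 11 := (semi_X R).pow_right 2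
  calc b0 a c * b0 a c = r a c 11 * c ^ 2 * (r a c 11 * c ^ 2) := rfl
    _ = r a c 11 * c ^ 2 * (c⁻¹ ^ 2 * r a c 11) := by rw [h]
    _ = r a c 11 * r a c 11 := by group
    _ = 1 := X_sq R

theorem b0_inv (R : Rules a c) : (b0 a c)⁻¹ = b0 a c := by
  rw [inv_eq_iff_mul_eq_one, b0_sq R]

theorem x_mul_b0 (R : Rules a c) : x a b c * b0 a c = b := by
  rw [x, mul_assoc, b0_sq R, mul_one]

theorem comm_x (R : Rules a c) (hb : b ^ 2 = 1) (hbc : (b * c) ^ 2 = 1) :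
    Commute (x a b c) c := by
  have h : SemiconjBy b c⁻¹ c := by
    have hb' : b⁻¹ = b := by rw [inv_eq_iff_mul_eq_one, ← sq, hb]
    have h1 : b * c * (b * c) = 1 := by rw [← sq, hbc]
    have h2 : (b * c)⁻¹ = b * c := by rw [inv_eq_iff_mul_eq_one, h1]
    rw [mul_inv_rev, hb'] at h2
    unfold SemiconjBy
    calc b * c⁻¹ = b * (c⁻¹ * b) * b⁻¹ := by group
      _ = b * (b * c) * b := by rw [h2, hb']
      _ = b ^ 2 * (c * b) := by simp only [sq, mul_assoc]
      _ = c * b := by rw [hb, one_mul]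
  exact h.mul_left (semi_b0 R)

theorem conj_of {g : G} {i j : Fin 12} {k : ℕ} (hx : Commute (x a b c) c)
    (h : g * r a c i = r a c j * c ^ k) : g * y a b c i * g⁻¹ = y a b c j := by
  have h2 : c ^ k * x a b c = x a b c * c ^ k := (hx.pow_right k).eq.symm
  calc g * y a b c i * g⁻¹ = (g * r a c i) * x a b c * (g * r a c i)⁻¹ := by
        unfold y; group
    _ = r a c j * (c ^ k * x a b c) * (c ^ k)⁻¹ * (r a c j)⁻¹ := by rw [h]; group
    _ = y a b c j := by rw [h2]; unfold y; group

theorem conj_a (R : Rules a c) (hx : Commute (x a b c) c) (i : Fin 12) :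
    a * y a b c i * a⁻¹ = y a b c (pa i) := conj_of hx (a_mul_r R i)

theorem conj_c (R : Rules a c) (hx : Commute (x a b c) c) (i : Fin 12) :
    c * y a b c i * c⁻¹ = y a b c (pc i) := conj_of hx (c_mul_r R i)

theorem conj_b0 (R : Rules a c) (hx : Commute (x a b c) c) (i : Fin 12) :
    b0 a c * y a b c i * (b0 a c)⁻¹ = y a b c (pb i) := by
  have h : ∀ i, pb i = pa (pc (pc (pc (pa (pc (pc (pa (pc (pc i))))))))) := by decide
  rw [h]
  simp only [← conj_a R hx, ← conj_c R hx]
  simp [b0, r, pow_succ, mul_assoc]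

theorem y_zero : y a b c 0 = x a b c := by simp [y, r]

theorem y_op (R : Rules a c) (hx : Commute (x a b c) c) (hb : b ^ 2 = 1) (i : Fin 12) :
    y a b c i * y a b c (op i) = 1 := by
  refine orbit_ind (fun i => y a b c i * y a b c (op i) = 1) ?_ ?_ ?_ i
  · have h : op 0 = pb 0 := by decide
    rw [h, ← conj_b0 R hx, y_zero, b0_inv R, x]
    have h3 := b0_sq R
    rw [sq] at hb
    calc b * b0 a c * (b0 a c * (b * b0 a c) * b0 a c)
        = b * (b0 a c * b0 a c) * b * (b0 a c * b0 a c) := by simp only [mul_assoc]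
      _ = 1 := by rw [h3, mul_one, mul_one, hb]
  · intro i hi
    have h : ∀ i, op (pa i) = pa (op i) := by decide
    simp only [h, ← conj_a R hx]
    calc _ = a * (y a b c i * y a b c (op i)) * a⁻¹ := by group
      _ = 1 := by rw [hi]; group
  · intro i hi
    have h : ∀ i, op (pc i) = pc (op i) := by decide
    simp only [h, ← conj_c R hx]
    calc _ = c * (y a b c i * y a b c (op i)) * c⁻¹ := by group
      _ = 1 := by rw [hi]; group

/-- The product of five face pairings. -/
def e5 (a b c : G) (i j k l m : Fin 12) : G :=
  y a b c i * y a b c j * y a b c k * y a b c l * y a b c m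

theorem e5_a (R : Rules a c) (hx : Commute (x a b c) c) {i j k l m : Fin 12}
    (h : e5 a b c i j k l m = 1) : e5 a b c (pa i) (pa j) (pa k) (pa l) (pa m) = 1 := by
  unfold e5 at *
  simp only [← conj_a R hx]
  calc _ = a * (y a b c i * y a b c j * y a b c k * y a b c l * y a b c m) * a⁻¹ := by group
    _ = 1 := by rw [h]; group

theorem e5_c (R : Rules a c) (hx : Commute (x a b c) c) {i j k l m : Fin 12}
    (h : e5 a b c i j k l m = 1) : e5 a b c (pc i) (pc j) (pc k) (pc l) (pc m) = 1 := by
  unfold e5 at *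
  simp only [← conj_c R hx]
  calc _ = c * (y a b c i * y a b c j * y a b c k * y a b c l * y a b c m) * c⁻¹ := by group
    _ = 1 := by rw [h]; group

theorem ab0_five (R : Rules a c) : (a * b0 a c) ^ 5 = 1 := by
  have h : a * b0 a c = (c ^ 3 * a) * c ^ 2 * (c ^ 3 * a)⁻¹ := by
    rw [mul_inv_rev, a_inv R, ← inv_pow, c_inv R]
    simp [b0, r, pow_succ, mul_assoc, R.aa', R.cc']
  rw [h, conj_pow, ← pow_mul, mul_comm, pow_mul, c_pow_five R]
  group

theorem edge (R : Rules a c) (hx : Commute (x a b c) c) (hab : (a * b) ^ 5 = 1) :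
    e5 a b c 1 8 6 2 11 = 1 := by
  have hg : ∀ i, (a * b0 a c) * y a b c i * (a * b0 a c)⁻¹ = y a b c (pa (pb i)) := by
    intro i
    rw [← conj_a R hx, ← conj_b0 R hx]
    group
  have h1 : a * b = y a b c 1 * (a * b0 a c) := by
    have : y a b c 1 = y a b c (pa 0) := rfl
    rw [this, ← conj_a R hx, y_zero]
    conv_lhs => rw [← x_mul_b0 (b := b) R]
    group
  have h5 := ab0_five R
  generalize a * b0 a c = g at *
  have q1 := hg 1
  have q2 := hg 8
  have q3 := hg 6
  have q4 := hg 2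
  change _ = y a b c 8 at q1
  change _ = y a b c 6 at q2
  change _ = y a b c 2 at q3
  change _ = y a b c 11 at q4
  rw [h1] at hab
  unfold e5
  rw [← q4, ← q3, ← q2, ← q1, ← hab]
  have h6 : ∀ u : G, (u * g) ^ 5 = (u * g) ^ 5 * (g ^ 5)⁻¹ := fun u => by rw [h5]; group
  rw [h6]
  simp only [pow_succ, pow_zero, one_mul]
  group

/-- All elements of `⟨a, c⟩` are in normal form. -/
theorem mem_H (R : Rules a c) {h : G} (hh : h ∈ Subgroup.closure {a, c}) :
    ∃ i, ∃ k : ℕ, h = r a c i * c ^ k := by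
  have ha' : ∀ g, (∃ i, ∃ k : ℕ, g = r a c i * c ^ k) →
      ∃ i, ∃ k : ℕ, a * g = r a c i * c ^ k := by
    rintro _ ⟨i, k, rfl⟩
    exact ⟨pa i, ka i + k, by rw [← mul_assoc, a_mul_r R, mul_assoc, pow_add]⟩
  have hc' : ∀ g, (∃ i, ∃ k : ℕ, g = r a c i * c ^ k) →
      ∃ i, ∃ k : ℕ, c * g = r a c i * c ^ k := by
    rintro _ ⟨i, k, rfl⟩
    exact ⟨pc i, kc i + k, by rw [← mul_assoc, c_mul_r R, mul_assoc, pow_add]⟩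
  induction hh using Subgroup.closure_induction_left with
  | one => exact ⟨0, 0, by simp [r]⟩
  | mul_left g hg z hz ih =>
    rcases hg with rfl | rfl
    · exact ha' _ ih
    · exact hc' _ ih
  | inv_mul_cancel g hg z hz ih =>
    rcases hg with rfl | rfl
    · rw [a_inv R]; exact ha' _ ih
    · rw [c_inv R]
      have : g ^ 4 * z = g * (g * (g * (g * z))) := by
        simp only [pow_succ, pow_zero, one_mul, mul_assoc]
      rw [this]
      exact hc' _ (hc' _ (hc' _ (hc' _ ih)))

theorem a_mem : a ∈ Subgroup.closure {a, c} := Subgroup.subset_closure (by simp)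
theorem c_mem : c ∈ Subgroup.closure {a, c} := Subgroup.subset_closure (by simp)

theorem b0_mem : b0 a c ∈ Subgroup.closure {a, c} := by
  have ha := a_mem (a := a) (c := c)
  have hc := c_mem (a := a) (c := c)
  have : b0 a c = a * c ^ 3 * a * c ^ 2 * a * c ^ 2 := by simp [b0, r]
  rw [this]
  exact mul_mem (mul_mem (mul_mem (mul_mem (mul_mem ha (pow_mem hc _)) ha) (pow_mem hc _)) ha)
    (pow_mem hc _)

theorem decomp (R : Rules a c) (hx : Commute (x a b c) c) (hb : b ^ 2 = 1)
    (htop : Subgroup.closure {a, b, c} = ⊤) (g : G) :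
    ∃ n ∈ Subgroup.closure (Set.range (y a b c)), ∃ h ∈ Subgroup.closure {a, c}, g = n * h := by
  have hg : g ∈ Subgroup.closure {a, b, c} := by rw [htop]; trivial
  have hb' : b⁻¹ = b := by rw [inv_eq_iff_mul_eq_one, ← sq, hb]
  have key : ∀ g, (∃ n ∈ Subgroup.closure (Set.range (y a b c)),
      ∃ h ∈ Subgroup.closure {a, c}, g = n * h) → (∃ n ∈ Subgroup.closure (Set.range (y a b c)),
      ∃ h ∈ Subgroup.closure {a, c}, g * b = n * h) := by
    rintro _ ⟨n, hn, h, hh, rfl⟩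
    obtain ⟨i, k, hik⟩ := mem_H R hh
    have h3 : h * y a b c 0 * h⁻¹ = y a b c i := by
      apply conj_of (k := k) hx
      rw [← hik]; simp [r]
    refine ⟨n * y a b c i, mul_mem hn (Subgroup.subset_closure ⟨i, rfl⟩), h * b0 a c,
      mul_mem hh b0_mem, ?_⟩
    rw [← h3, y_zero]
    conv_lhs => rw [← x_mul_b0 (b := b) R]
    group
  have key2 : ∀ g, ∀ s ∈ Subgroup.closure {a, c}, (∃ n ∈ Subgroup.closure (Set.range (y a b c)),
      ∃ h ∈ Subgroup.closure {a, c}, g = n * h) → (∃ n ∈ Subgroup.closure (Set.range (y a b c)),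
      ∃ h ∈ Subgroup.closure {a, c}, g * s = n * h) := by
    rintro _ s hs ⟨n, hn, h, hh, rfl⟩
    exact ⟨n, hn, h * s, mul_mem hh hs, by rw [mul_assoc]⟩
  induction hg using Subgroup.closure_induction_right with
  | one => exact ⟨1, one_mem _, 1, one_mem _, by simp⟩
  | mul_right z hz s hs ih =>
    rcases hs with rfl | rfl | rfl
    · exact key2 _ _ a_mem ih
    · exact key _ ih
    · exact key2 _ _ c_mem ih
  | mul_inv_cancel z hz s hs ih =>
    rcases hs with rfl | rfl | rfl
    · exact key2 _ _ (inv_mem a_mem) ih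
    · rw [hb']; exact key _ ih
    · exact key2 _ _ (inv_mem c_mem) ih

end grp

theorem map_r {G H : Type*} [Group G] [Group H] (f : G →* H) (a c : G) (i : Fin 12) :
    f (r a c i) = r (f a) (f c) i := by
  fin_cases i <;> simp [r]

theorem map_y {G H : Type*} [Group G] [Group H] (f : G →* H) (a b c : G) (i : Fin 12) :
    f (y a b c i) = y (f a) (f b) (f c) i := by
  simp [y, x, b0, map_r]

/-- The permutation image of `a`. -/
abbrev qa : Equiv.Perm (Fin 5) := Equiv.swap 1 2 * Equiv.swap 3 4
/-- The permutation image of `b`. -/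
abbrev qb : Equiv.Perm (Fin 5) := Equiv.swap 0 1 * Equiv.swap 2 4
/-- The permutation image of `c`. -/
abbrev qc : Equiv.Perm (Fin 5) := finRotate 5

theorem perm_faithful : ∀ i : Fin 12, ∀ k : Fin 5,
    r qa qc i * qc ^ (k : ℕ) = 1 → i = 0 ∧ k = 0 := by
  decide +kernel

theorem perm_x : x qa qb qc = 1 := by
  decide +kernel

section lower

/-- The module. -/
abbrev V := ZMod 5 × ZMod 5 × ZMod 5

/-- Action of `a`. -/
def fa : V → V := fun v => (v.2.1 + 2 * v.2.2, v.1 + 2 * v.2.2, 4 * v.2.2)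
/-- Action of `b`. -/
def fb : V → V := fun v => (4 * v.1 + 1, 4 * v.2.2, 4 * v.2.1)
/-- Action of `c`. -/
def fc : V → V := fun v => (v.1 + 2 * v.2.2, 4 * v.2.2, v.2.1 + 2 * v.2.2)
/-- Inverse action of `c`. -/
def fc' : V → V := fun v => (v.1 + 2 * v.2.1, v.2.2 + 2 * v.2.1, 4 * v.2.1)

/-- Permutation for `a`. -/
def Pa : Equiv.Perm V := ⟨fa, fa, by decide +kernel, by decide +kernel⟩
/-- Permutation for `b`. -/
def Pb : Equiv.Perm V := ⟨fb, fb, by decide +kernel, by decide +kernel⟩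
/-- Permutation for `c`. -/
def Pc : Equiv.Perm V := ⟨fc, fc', by decide +kernel, by decide +kernel⟩

/-- The translation vectors. -/
def tv : Fin 12 → V := ![(1, 0, 0), (0, 1, 0), (0, 0, 1), (2, 4, 2), (1, 3, 3), (2, 2, 4),
  (3, 1, 3), (4, 2, 2), (3, 3, 1), (0, 4, 0), (0, 0, 4), (4, 0, 0)]

theorem Pa2 : Pa ^ 2 = 1 := Equiv.ext (by decide +kernel)
theorem Pb2 : Pb ^ 2 = 1 := Equiv.ext (by decide +kernel)
theorem Pc5 : Pc ^ 5 = 1 := Equiv.ext (by decide +kernel)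
theorem Pbc : (Pb * Pc) ^ 2 = 1 := Equiv.ext (by decide +kernel)
theorem Pca : (Pc * Pa) ^ 3 = 1 := Equiv.ext (by decide +kernel)
theorem Pab : (Pa * Pb) ^ 5 = 1 := Equiv.ext (by decide +kernel)
theorem Py : ∀ i, ∀ v, y Pa Pb Pc i v = tv i + v := by decide +kernel

/-- The affine action of `Γ⁺`. -/
def Psi : GammaPlus →* Equiv.Perm V :=
  PresentedGroup.toGroup (f := fun g => match g with
    | Gen.a => Pa
    | Gen.b => Pb
    | Gen.c => Pc) (by
    intro w hw
    rcases hw with rfl | rfl | rfl | rfl | rfl | rfl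
    · simpa using Pa2
    · simpa using Pb2
    · simpa using Pc5
    · simpa using Pbc
    · simpa using Pca
    · simpa using Pab)

/-- Generator. -/
abbrev ga : GammaPlus := PresentedGroup.of Gen.a
/-- Generator. -/
abbrev gb : GammaPlus := PresentedGroup.of Gen.b
/-- Generator. -/
abbrev gc : GammaPlus := PresentedGroup.of Gen.c

theorem Psi_y (i : Fin 12) (v : V) : Psi (y ga gb gc i) v = tv i + v := by
  rw [map_y]
  have h1 : Psi ga = Pa := PresentedGroup.toGroup.of _
  have h2 : Psi gb = Pb := PresentedGroup.toGroup.of _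
  have h3 : Psi gc = Pc := PresentedGroup.toGroup.of _
  rw [h1, h2, h3, Py]

theorem Psi_trans {g : GammaPlus} (hg : g ∈ Subgroup.closure (Set.range (y ga gb gc))) :
    ∀ v, Psi g v = Psi g 0 + v := by
  induction hg using Subgroup.closure_induction with
  | mem g hg =>
    obtain ⟨i, rfl⟩ := hg
    intro v
    simp [Psi_y]
  | one => simp
  | mul g h _ _ ih1 ih2 =>
    intro v
    simp only [map_mul, Equiv.Perm.mul_apply]
    rw [ih1, ih2 v, ih1 (Psi h 0), add_assoc]
  | inv g _ ih =>
    intro v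
    rw [map_inv, Equiv.Perm.inv_eq_iff_eq, ih]
    have h : Psi g ((Psi g)⁻¹ 0) = 0 := by simp
    rw [ih] at h
    rw [← add_assoc, h, zero_add]

end lower

theorem rel_mem {w : FreeGroup Gen} (h : w ∈ rels) :
    (PresentedGroup.mk rels w) = 1 := PresentedGroup.one_of_mem h

theorem ga2 : ga ^ 2 = 1 := rel_mem (w := FreeGroup.of Gen.a ^ 2) (by simp [rels])
theorem gb2 : gb ^ 2 = 1 := rel_mem (w := FreeGroup.of Gen.b ^ 2) (by simp [rels])
theorem gc5 : gc ^ 5 = 1 := rel_mem (w := FreeGroup.of Gen.c ^ 5) (by simp [rels])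
theorem gbc : (gb * gc) ^ 2 = 1 :=
  rel_mem (w := (FreeGroup.of Gen.b * FreeGroup.of Gen.c) ^ 2) (by simp [rels])
theorem gca : (gc * ga) ^ 3 = 1 :=
  rel_mem (w := (FreeGroup.of Gen.c * FreeGroup.of Gen.a) ^ 3) (by simp [rels])
theorem gab : (ga * gb) ^ 5 = 1 :=
  rel_mem (w := (FreeGroup.of Gen.a * FreeGroup.of Gen.b) ^ 5) (by simp [rels])

theorem gR : Rules ga gc := mkRules ga2 gc5 gca
theorem gx : Commute (x ga gb gc) gc := comm_x gR gb2 gbc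

theorem gtop : Subgroup.closure {ga, gb, gc} = ⊤ := by
  rw [eq_top_iff, ← PresentedGroup.closure_range_of rels]
  apply Subgroup.closure_mono
  rintro _ ⟨g, rfl⟩
  cases g <;> simp

theorem ker_eq (f : GammaPlus →* Equiv.Perm (Fin 5)) (ha : f ga = qa) (hb : f gb = qb)
    (hc : f gc = qc) : f.ker = Subgroup.closure (Set.range (y ga gb gc)) := by
  have hy : Subgroup.closure (Set.range (y ga gb gc)) ≤ f.ker := by
    rw [Subgroup.closure_le]
    rintro _ ⟨i, rfl⟩
    simp only [SetLike.mem_coe, MonoidHom.mem_ker]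
    rw [map_y, ha, hb, hc, y, perm_x]
    group
  refine le_antisymm ?_ hy
  intro g hg
  obtain ⟨n, hn, h, hh, rfl⟩ := decomp gR gx gb2 gtop g
  obtain ⟨i, k, rfl⟩ := mem_H gR hh
  have h1 : f n = 1 := hy hn
  have h2 : f (n * (r ga gc i * gc ^ k)) = 1 := hg
  have h3 : gc ^ k = gc ^ (k % 5) := pow_eq_pow_mod k gc5
  rw [map_mul, h1, one_mul, map_mul, map_r, h3, map_pow, ha, hc] at h2
  obtain ⟨rfl, hk⟩ := perm_faithful i ⟨k % 5, Nat.mod_lt _ (by norm_num)⟩ h2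
  have hk' : k % 5 = 0 := congrArg Fin.val hk
  rw [h3, hk']
  simpa [r] using hn

/-- Linear algebra: the six edge relations. -/
theorem lin {A : Type*} [AddCommGroup A] (z : Fin 12 → A) (hop : ∀ i, z i + z (op i) = 0)
    (h1 : z 1 + z 8 + z 6 + z 2 + z 11 = 0) (h2 : z 2 + z 9 + z 7 + z 3 + z 11 = 0)
    (h3 : z 5 + z 11 + z 4 + z 6 + z 9 = 0) (h4 : z 3 + z 10 + z 8 + z 4 + z 11 = 0)
    (h5 : z 1 + z 11 + z 5 + z 7 + z 10 = 0) (h6 : z 6 + z 8 + z 10 + z 7 + z 9 = 0) :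
    (∀ i, (5 : ℤ) • z i = 0) ∧ ∀ i, ∃ p q s : ℤ, z i = p • z 0 + q • z 1 + s • z 2 := by
  have o0 : z 11 = - z 0 := (neg_eq_of_add_eq_zero_right (hop 0)).symm
  have o1 : z 9 = - z 1 := (neg_eq_of_add_eq_zero_right (hop 1)).symm
  have o2 : z 10 = - z 2 := (neg_eq_of_add_eq_zero_right (hop 2)).symm
  have o3 : z 6 = - z 3 := (neg_eq_of_add_eq_zero_right (hop 3)).symm
  have o4 : z 7 = - z 4 := (neg_eq_of_add_eq_zero_right (hop 4)).symm
  have o5 : z 8 = - z 5 := (neg_eq_of_add_eq_zero_right (hop 5)).symm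
  rw [o0, o3, o5] at h1
  rw [o0, o1, o4] at h2
  rw [o0, o1, o3] at h3
  rw [o0, o2, o5] at h4
  rw [o0, o2, o4] at h5
  rw [o1, o2, o3, o4, o5] at h6
  have f0 : (5 : ℤ) • z 0 = 0 := by
    linear_combination (norm := module) (-1 : ℤ) • h1 - h2 - h3 - h4 - h5
  have f1 : (5 : ℤ) • z 1 = 0 := by
    linear_combination (norm := module) h1 - h2 - h3 + h5 - h6
  have f2 : (5 : ℤ) • z 2 = 0 := by
    linear_combination (norm := module) h1 + h2 - h4 - h5 - h6
  have f3 : (5 : ℤ) • z 3 = 0 := by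
    linear_combination (norm := module) (-1 : ℤ) • h1 + h2 - h3 + h4 - h6
  have f4 : (5 : ℤ) • z 4 = 0 := by
    linear_combination (norm := module) (-1 : ℤ) • h2 + h3 + h4 - h5 - h6
  have f5 : (5 : ℤ) • z 5 = 0 := by
    linear_combination (norm := module) (-1 : ℤ) • h1 + h3 - h4 + h5 - h6
  have g3 : z 3 = (2 : ℤ) • z 0 + (-1 : ℤ) • z 1 + (2 : ℤ) • z 2 := by
    linear_combination (norm := module) h4 + h5
  have g4 : z 4 = (1 : ℤ) • z 0 + (-2 : ℤ) • z 1 + (-2 : ℤ) • z 2 := by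
    linear_combination (norm := module) h1 - h6
  have g5 : z 5 = (2 : ℤ) • z 0 + (2 : ℤ) • z 1 + (-1 : ℤ) • z 2 := by
    linear_combination (norm := module) h2 + h3
  have hneg : ∀ w : A, (5 : ℤ) • w = 0 → (5 : ℤ) • (-w) = 0 := by
    intro w hw; rw [smul_neg, hw, neg_zero]
  have gneg : ∀ w : A, (∃ p q s : ℤ, w = p • z 0 + q • z 1 + s • z 2) →
      ∃ p q s : ℤ, -w = p • z 0 + q • z 1 + s • z 2 := by
    rintro _ ⟨p, q, s, rfl⟩
    exact ⟨-p, -q, -s, by module⟩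
  have e0 : ∃ p q s : ℤ, z 0 = p • z 0 + q • z 1 + s • z 2 := ⟨1, 0, 0, by simp⟩
  have e1 : ∃ p q s : ℤ, z 1 = p • z 0 + q • z 1 + s • z 2 := ⟨0, 1, 0, by simp⟩
  have e2 : ∃ p q s : ℤ, z 2 = p • z 0 + q • z 1 + s • z 2 := ⟨0, 0, 1, by simp⟩
  have e3 : ∃ p q s : ℤ, z 3 = p • z 0 + q • z 1 + s • z 2 := ⟨_, _, _, g3⟩
  have e4 : ∃ p q s : ℤ, z 4 = p • z 0 + q • z 1 + s • z 2 := ⟨_, _, _, g4⟩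
  have e5 : ∃ p q s : ℤ, z 5 = p • z 0 + q • z 1 + s • z 2 := ⟨_, _, _, g5⟩
  constructor
  · intro i
    fin_cases i
    · exact f0
    · exact f1
    · exact f2
    · exact f3
    · exact f4
    · exact f5
    · exact o3 ▸ hneg _ f3
    · exact o4 ▸ hneg _ f4
    · exact o5 ▸ hneg _ f5
    · exact o1 ▸ hneg _ f1
    · exact o2 ▸ hneg _ f2
    · exact o0 ▸ hneg _ f0
  · intro i
    fin_cases i
    · exact e0
    · exact e1
    · exact e2
    · exact e3
    · exact e4
    · exact e5
    · exact o3 ▸ gneg _ e3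
    · exact o4 ▸ gneg _ e4
    · exact o5 ▸ gneg _ e5
    · exact o1 ▸ gneg _ e1
    · exact o2 ▸ gneg _ e2
    · exact o0 ▸ gneg _ e0

theorem V_decomp : ∀ v : V, v = v.1.val • ((1, 0, 0) : V) + v.2.1.val • ((0, 1, 0) : V) +
    v.2.2.val • ((0, 0, 1) : V) := by
  decide +kernel

theorem equiv_of {A : Type*} [AddCommGroup A] (z : Fin 12 → A) (T : A →+ V)
    (hT : ∀ i, T (z i) = tv i) (h5 : ∀ i, (5 : ℤ) • z i = 0)
    (hgen : ∀ i, ∃ p q s : ℤ, z i = p • z 0 + q • z 1 + s • z 2)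
    (hspan : ∀ S : AddSubgroup A, (∀ i, z i ∈ S) → ∀ w, w ∈ S) : Nonempty (V ≃+ A) := by
  have hL : ∀ i, ∃ l : ZMod 5 →+ A, l 1 = z i := by
    intro i
    refine ⟨ZMod.lift 5 ⟨zmultiplesHom _ (z i), by simpa using h5 i⟩, ?_⟩
    have := ZMod.lift_coe 5 ⟨zmultiplesHom _ (z i), by simpa using h5 i⟩ 1
    simpa using this
  choose L hL using hL
  obtain ⟨F, hF0, hF1, hF2⟩ : ∃ F : V →+ A,
      F (1, 0, 0) = z 0 ∧ F (0, 1, 0) = z 1 ∧ F (0, 0, 1) = z 2 :=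
    ⟨(L 0).coprod ((L 1).coprod (L 2)), by simp [hL], by simp [hL], by simp [hL]⟩
  have t0 : tv 0 = (1, 0, 0) := rfl
  have t1 : tv 1 = (0, 1, 0) := rfl
  have t2 : tv 2 = (0, 0, 1) := rfl
  have hinj : Function.Injective F := by
    apply Function.LeftInverse.injective (g := T)
    intro v
    have hv := V_decomp v
    have : T (F v) = v.1.val • ((1, 0, 0) : V) + v.2.1.val • ((0, 1, 0) : V) +
        v.2.2.val • ((0, 0, 1) : V) := by
      conv_lhs => rw [hv]
      simp only [map_add, map_nsmul, hF0, hF1, hF2, hT, t0, t1, t2]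
    rw [this, ← hv]
  have hzr : ∀ i, z i ∈ F.range := by
    intro i
    obtain ⟨p, q, s, h⟩ := hgen i
    rw [h, ← hF0, ← hF1, ← hF2]
    exact add_mem (add_mem (zsmul_mem (AddMonoidHom.mem_range.2 ⟨_, rfl⟩) _) (zsmul_mem (AddMonoidHom.mem_range.2 ⟨_, rfl⟩) _)) (zsmul_mem (AddMonoidHom.mem_range.2 ⟨_, rfl⟩) _)
  exact ⟨AddEquiv.ofBijective F ⟨hinj, fun w => hspan F.range hzr w⟩⟩

/-- The translation homomorphism. -/
def tHom (K : Subgroup GammaPlus) (hK : K = Subgroup.closure (Set.range (y ga gb gc))) :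
    K →* Multiplicative V where
  toFun k := Multiplicative.ofAdd (Psi k 0)
  map_one' := by simp
  map_mul' := by
    intro g h
    rw [← ofAdd_add]
    congr 1
    simp only [Subgroup.coe_mul, map_mul, Equiv.Perm.mul_apply]
    exact Psi_trans (hK ▸ g.2) _

theorem tHom_y (K : Subgroup GammaPlus) (hK : K = Subgroup.closure (Set.range (y ga gb gc)))
    (i : Fin 12) (h : y ga gb gc i ∈ K) :
    tHom K hK ⟨y ga gb gc i, h⟩ = Multiplicative.ofAdd (tv i) := by
  change Multiplicative.ofAdd (Psi (y ga gb gc i) 0) = _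
  rw [Psi_y, add_zero]

theorem main (K : Subgroup GammaPlus) (hK : K = Subgroup.closure (Set.range (y ga gb gc))) :
    Nonempty (Abelianization K ≃* Multiplicative V) := by
  have hmem : ∀ i, y ga gb gc i ∈ K := fun i => by
    rw [hK]; exact Subgroup.subset_closure ⟨i, rfl⟩
  obtain ⟨yk, hyk⟩ : ∃ yk : Fin 12 → K, ∀ i, yk i = ⟨y ga gb gc i, hmem i⟩ := ⟨_, fun _ => rfl⟩
  have hyv : ∀ i, (yk i : GammaPlus) = y ga gb gc i := fun i => by rw [hyk]
  obtain ⟨z, hz⟩ : ∃ z : Fin 12 → Additive (Abelianization K),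
    ∀ i, z i = Additive.ofMul (Abelianization.of (yk i)) := ⟨_, fun _ => rfl⟩
  have hop : ∀ i, z i + z (op i) = 0 := by
    intro i
    have h : yk i * yk (op i) = 1 := by
      apply Subtype.ext
      rw [Subgroup.coe_mul, hyv, hyv, y_op gR gx gb2 i, Subgroup.coe_one]
    rw [hz, hz, ← ofMul_mul, ← map_mul, h, map_one, ofMul_one]
  have he : ∀ {i j k l m : Fin 12}, e5 ga gb gc i j k l m = 1 →
      z i + z j + z k + z l + z m = 0 := by
    intro i j k l m h
    have h : yk i * yk j * yk k * yk l * yk m = 1 := by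
      apply Subtype.ext
      simp only [Subgroup.coe_mul, hyv, Subgroup.coe_one]
      exact h
    simp only [hz, ← ofMul_mul, ← map_mul]
    rw [h, map_one, ofMul_one]
  have r1 : e5 ga gb gc 1 8 6 2 11 = 1 := edge gR gx gab
  have r2 : e5 ga gb gc 2 9 7 3 11 = 1 := by
    have h := e5_c gR gx r1
    rwa [show pc 1 = 2 from rfl, show pc 8 = 9 from rfl, show pc 6 = 7 from rfl,
      show pc 2 = 3 from rfl, show pc 11 = 11 from rfl] at h
  have r3 : e5 ga gb gc 5 11 4 6 9 = 1 := by
    have h := e5_a gR gx r2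
    rwa [show pa 2 = 5 from rfl, show pa 9 = 11 from rfl, show pa 7 = 4 from rfl,
      show pa 3 = 6 from rfl, show pa 11 = 9 from rfl] at h
  have r4 : e5 ga gb gc 3 10 8 4 11 = 1 := by
    have h := e5_c gR gx r2
    rwa [show pc 2 = 3 from rfl, show pc 9 = 10 from rfl, show pc 7 = 8 from rfl,
      show pc 3 = 4 from rfl, show pc 11 = 11 from rfl] at h
  have r5 : e5 ga gb gc 1 11 5 7 10 = 1 := by
    have h := e5_c gR gx r3
    rwa [show pc 5 = 1 from rfl, show pc 11 = 11 from rfl, show pc 4 = 5 from rfl,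
      show pc 6 = 7 from rfl, show pc 9 = 10 from rfl] at h
  have r6 : e5 ga gb gc 6 8 10 7 9 = 1 := by
    have h := e5_a gR gx r4
    rwa [show pa 3 = 6 from rfl, show pa 10 = 8 from rfl, show pa 8 = 10 from rfl,
      show pa 4 = 7 from rfl, show pa 11 = 9 from rfl] at h
  obtain ⟨h5, hgen⟩ := lin z hop (he r1) (he r2) (he r3) (he r4) (he r5) (he r6)
  have hT : ∀ i, MonoidHom.toAdditiveLeft (Abelianization.lift (tHom K hK)) (z i) = tv i := by
    intro i
    rw [hz]
    change Multiplicative.toAdd (Abelianization.lift (tHom K hK) (Abelianization.of (yk i))) = _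
    rw [Abelianization.lift_apply_of, hyk, tHom_y, toAdd_ofAdd]
  have hspan : ∀ S : AddSubgroup (Additive (Abelianization K)), (∀ i, z i ∈ S) →
      ∀ w, w ∈ S := by
    intro S hS w
    have key : ∀ g (hg : g ∈ Subgroup.closure (Set.range (y ga gb gc))) (hg' : g ∈ K),
        Additive.ofMul (Abelianization.of (⟨g, hg'⟩ : K)) ∈ S := by
      intro g hg
      induction hg using Subgroup.closure_induction with
      | mem g hg =>
        obtain ⟨i, rfl⟩ := hg
        intro _
        have := hS i
        rwa [hz, hyk] at this
      | one => intro _; exact zero_mem S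
      | mul g h hg hh ih1 ih2 =>
        intro _
        exact add_mem (ih1 (hK ▸ hg)) (ih2 (hK ▸ hh))
      | inv g hg ih =>
        intro _
        exact neg_mem (ih (hK ▸ hg))
    obtain ⟨k, hk⟩ := QuotientGroup.mk'_surjective _ (Additive.toMul w)
    have := key k (hK ▸ k.2) k.2
    have h2 : Additive.ofMul (Abelianization.of k) = w := congrArg Additive.ofMul hk
    rwa [← h2]
  obtain ⟨E⟩ := equiv_of z _ hT h5 hgen hspan
  exact ⟨(AddEquiv.toMultiplicativeLeft E).symm⟩

end SW

/-- Let `φ : Γ⁺ → A₅` be the surjective homomorphism with `φ(a) = (2 3)(4 5)`,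
`φ(b) = (1 2)(3 5)`, `φ(c) = (1 2 3 4 5)` and let `K = ker φ` (the fundamental
group of the Seifert–Weber dodecahedral space). Then the abelianization of `K`
is isomorphic to `(ℤ/5ℤ)³`. -/
theorem abelianization_ker_eq_zmod5_cubed (φ : GammaPlus →* alternatingGroup (Fin 5))
    (hsurj : Function.Surjective φ)
    (ha : (φ (PresentedGroup.of Gen.a) : Equiv.Perm (Fin 5)) = Equiv.swap 1 2 * Equiv.swap 3 4)
    (hb : (φ (PresentedGroup.of Gen.b) : Equiv.Perm (Fin 5)) = Equiv.swap 0 1 * Equiv.swap 2 4)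
    (hc : (φ (PresentedGroup.of Gen.c) : Equiv.Perm (Fin 5)) = finRotate 5) :
    Nonempty (Abelianization φ.ker ≃* Multiplicative (ZMod 5 × ZMod 5 × ZMod 5)) := by
  have h := SW.ker_eq ((alternatingGroup (Fin 5)).subtype.comp φ) ha hb hc
  refine SW.main φ.ker ?_
  rw [← h]
  ext g
  simp [MonoidHom.mem_ker]
end

section
/- Let φ : Γ⁺ → A₅ be the surjective homomorphism with φ(a) = (2 3)(4 5), φ(b) = (1 2)(3 5), φ(c) = (1 2 3 4 5), and let K = ker φ. Then every group homomorphism from K to ℤ/2ℤ is trivial. -/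
/-- The normal forms of the subgroup generated by `a` and `c`. -/
def NF {G : Type*} [Group G] (a c h : G) : Prop :=
  (∃ i : ℤ, h = c ^ i) ∨ (∃ i j : ℤ, h = c ^ i * a * c ^ j) ∨
  (∃ i j : ℤ, h = c ^ i * (a * c ^ 2 * a) * c ^ j) ∨
  (∃ i : ℤ, h = c ^ i * (a * c ^ 2 * a * c ^ 3 * a))

theorem zpow_cases {G : Type*} [Group G] {c : G} (hc : c ^ 5 = 1) (j : ℤ) :
    c ^ j = 1 ∨ c ^ j = c ∨ c ^ j = c ^ 2 ∨ c ^ j = c ^ 3 ∨ c ^ j = c⁻¹ := by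
  have h5 : c ^ (5 : ℤ) = 1 := by exact_mod_cast hc
  have h : c ^ j = c ^ (j % 5) := by
    conv_lhs => rw [← Int.emod_add_mul_ediv j 5, zpow_add, zpow_mul, h5]
    simp
  have h1 : j % 5 = 0 ∨ j % 5 = 1 ∨ j % 5 = 2 ∨ j % 5 = 3 ∨ j % 5 = 4 := by omega
  have h4 : c ^ (4 : ℤ) = c⁻¹ := by
    rw [eq_inv_iff_mul_eq_one, ← zpow_add_one]; exact h5
  rw [h]
  rcases h1 with e | e | e | e | e <;> rw [e]
  · left; simp
  · right; left; simp
  · right; right; left; norm_cast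
  · right; right; right; left; norm_cast
  · right; right; right; right; exact h4

section
variable {G : Type*} [Group G] {a c : G}

theorem rel_aca (ha : a * a = 1) (hca : (c * a) ^ 3 = 1) : a * c * a = c⁻¹ * a * c⁻¹ := by
  have h : c * (a * c * a) * c * a = 1 := by rw [← hca]; simp only [pow_succ, pow_zero, one_mul, mul_assoc]
  have ha' : a⁻¹ = a := inv_eq_of_mul_eq_one_right ha
  have : a * c * a = c⁻¹ * (c * (a * c * a) * c * a) * a⁻¹ * c⁻¹ := by group
  rw [this, h, ha']; group

theorem rel_aCa (ha : a * a = 1) (hca : (c * a) ^ 3 = 1) : a * c⁻¹ * a = c * a * c := by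
  have ha' : a⁻¹ = a := inv_eq_of_mul_eq_one_right ha
  have h := congrArg (·⁻¹) (rel_aca ha hca)
  simp only [mul_inv_rev, inv_inv, ha'] at h
  rw [← mul_assoc, ← mul_assoc] at h
  exact h

theorem rel_ac3a (ha : a * a = 1) (hc : c ^ 5 = 1) (hca : (c * a) ^ 3 = 1) :
    a * c ^ 3 * a = c * (a * c ^ 2 * a) * c := by
  have h3 : c ^ 3 = c⁻¹ * c⁻¹ := by
    have : c ^ 3 = c ^ 5 * (c⁻¹ * c⁻¹) := by group
    rw [this, hc, one_mul]
  calc a * c ^ 3 * a = a * c⁻¹ * (a * a) * c⁻¹ * a := by rw [h3, ha]; group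
    _ = (a * c⁻¹ * a) * (a * c⁻¹ * a) := by group
    _ = _ := by rw [rel_aCa ha hca]; simp only [pow_succ, pow_zero, one_mul, mul_assoc]

theorem rel_22 (ha : a * a = 1) (hc : c ^ 5 = 1) (hca : (c * a) ^ 3 = 1) :
    a * c ^ 2 * a * c ^ 2 * a = c⁻¹ * (a * c ^ 2 * a) * c⁻¹ := by
  calc a * c ^ 2 * a * c ^ 2 * a = a * c * (c * (a * c ^ 2 * a) * c) * c⁻¹ := by
        simp only [pow_succ, pow_zero, one_mul, mul_assoc, mul_inv_cancel, mul_one]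
    _ = a * c * (a * c ^ 3 * a) * c⁻¹ := by rw [rel_ac3a ha hc hca]
    _ = (a * c * a) * c ^ 3 * a * c⁻¹ := by group
    _ = _ := by rw [rel_aca ha hca]; group

theorem rel_zc (ha : a * a = 1) (hc : c ^ 5 = 1) (hca : (c * a) ^ 3 = 1) :
    a * c ^ 2 * a * c ^ 3 * a * c = c⁻¹ * (a * c ^ 2 * a * c ^ 3 * a) := by
  have hm : c⁻¹ * c⁻¹ = c ^ 3 := by
    have : c ^ 3 = c ^ 5 * (c⁻¹ * c⁻¹) := by group
    rw [this, hc, one_mul]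
  calc a * c ^ 2 * a * c ^ 3 * a * c
      = a * c ^ 2 * a * c ^ 3 * a * c * (a * a) := by rw [ha, mul_one]
    _ = a * c ^ 2 * a * c ^ 3 * (a * c * a) * a := by group
    _ = (a * c ^ 2 * a * c ^ 2 * a) * c⁻¹ * a := by rw [rel_aca ha hca]; group
    _ = c⁻¹ * (a * c ^ 2 * a) * (c⁻¹ * c⁻¹) * a := by rw [rel_22 ha hc hca]; group
    _ = _ := by rw [hm]; group

theorem NF.mul_a (ha : a * a = 1) (hc : c ^ 5 = 1) (hca : (c * a) ^ 3 = 1) {h : G}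
    (hh : NF a c h) : NF a c (h * a) := by
  rcases hh with ⟨i, rfl⟩ | ⟨i, j, rfl⟩ | ⟨i, j, rfl⟩ | ⟨i, rfl⟩
  · exact Or.inr (Or.inl ⟨i, 0, by simp⟩)
  · rcases zpow_cases hc j with e | e | e | e | e <;> rw [e]
    · exact Or.inl ⟨i, by rw [mul_one, mul_assoc, ha, mul_one]⟩
    · refine Or.inr (Or.inl ⟨i - 1, -1, ?_⟩)
      calc _ = c ^ i * (a * c * a) := by group
        _ = _ := by rw [rel_aca ha hca]; group
    · exact Or.inr (Or.inr (Or.inl ⟨i, 0, by group⟩))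
    · refine Or.inr (Or.inr (Or.inl ⟨i + 1, 1, ?_⟩))
      calc _ = c ^ i * (a * c ^ 3 * a) := by group
        _ = _ := by rw [rel_ac3a ha hc hca]; group
    · refine Or.inr (Or.inl ⟨i + 1, 1, ?_⟩)
      calc _ = c ^ i * (a * c⁻¹ * a) := by group
        _ = _ := by rw [rel_aCa ha hca]; group
  · rcases zpow_cases hc j with e | e | e | e | e <;> rw [e]
    · refine Or.inr (Or.inl ⟨i, 2, ?_⟩)
      calc _ = c ^ i * (a * c ^ 2) * (a * a) := by group
        _ = _ := by rw [ha]; group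
    · refine Or.inr (Or.inl ⟨i - 1, -2, ?_⟩)
      calc _ = c ^ i * (a * c ^ 2) * (a * c * a) := by group
        _ = c ^ i * (a * c ^ 2) * (c⁻¹ * a * c⁻¹) := by rw [rel_aca ha hca]
        _ = c ^ i * (a * c * a) * c⁻¹ := by
          simp only [pow_succ, pow_zero, one_mul, mul_assoc, mul_inv_cancel_left]
        _ = _ := by rw [rel_aca ha hca]; group
    · refine Or.inr (Or.inr (Or.inl ⟨i - 1, -1, ?_⟩))
      calc _ = c ^ i * (a * c ^ 2 * a * c ^ 2 * a) := by group
        _ = _ := by rw [rel_22 ha hc hca]; group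
    · exact Or.inr (Or.inr (Or.inr ⟨i, by group⟩))
    · refine Or.inr (Or.inr (Or.inl ⟨i + 1, 2, ?_⟩))
      calc _ = c ^ i * (a * c ^ 2) * (a * c⁻¹ * a) := by group
        _ = c ^ i * (a * c ^ 3 * a) * c := by rw [rel_aCa ha hca]; group
        _ = c ^ (i + 1) * (a * c ^ 2 * a) * c ^ 2 := by
          rw [rel_ac3a ha hc hca, zpow_add_one]
          simp only [pow_succ, pow_zero, one_mul, mul_assoc]
        _ = _ := by norm_cast
  · refine Or.inr (Or.inr (Or.inl ⟨i, 3, ?_⟩))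
    calc _ = c ^ i * (a * c ^ 2 * a) * c ^ 3 * (a * a) := by group
      _ = _ := by rw [ha]; group

theorem NF.mul_c (ha : a * a = 1) (hc : c ^ 5 = 1) (hca : (c * a) ^ 3 = 1) {h : G}
    (hh : NF a c h) : NF a c (h * c) := by
  rcases hh with ⟨i, rfl⟩ | ⟨i, j, rfl⟩ | ⟨i, j, rfl⟩ | ⟨i, rfl⟩
  · exact Or.inl ⟨i + 1, by group⟩
  · exact Or.inr (Or.inl ⟨i, j + 1, by group⟩)
  · exact Or.inr (Or.inr (Or.inl ⟨i, j + 1, by group⟩))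
  · refine Or.inr (Or.inr (Or.inr ⟨i - 1, ?_⟩))
    rw [mul_assoc, rel_zc ha hc hca]; group

theorem NF.mul_pow_c (ha : a * a = 1) (hc : c ^ 5 = 1) (hca : (c * a) ^ 3 = 1) {h : G}
    (hh : NF a c h) (n : ℕ) : NF a c (h * c ^ n) := by
  induction n with
  | zero => simpa using hh
  | succ n ih => rw [pow_succ, ← mul_assoc]; exact ih.mul_c ha hc hca

theorem NF.of_mem (ha : a * a = 1) (hc : c ^ 5 = 1) (hca : (c * a) ^ 3 = 1) {h : G}
    (hh : h ∈ Subgroup.closure {a, c}) : NF a c h := by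
  induction hh using Subgroup.closure_induction_right with
  | one => exact Or.inl ⟨0, by simp⟩
  | mul_right x hx y hy ih =>
    rcases hy with rfl | rfl
    · exact ih.mul_a ha hc hca
    · exact ih.mul_c ha hc hca
  | mul_inv_cancel x hx y hy ih =>
    rcases hy with rfl | rfl
    · rw [inv_eq_of_mul_eq_one_right ha]; exact ih.mul_a ha hc hca
    · have : y⁻¹ = y ^ 4 := by
        rw [inv_eq_iff_mul_eq_one, ← pow_succ']; exact hc
      rw [this]; exact ih.mul_pow_c ha hc hca 4

end

/-- Image of `a`. -/
def A0 : alternatingGroup (Fin 5) :=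
  ⟨Equiv.swap 1 2 * Equiv.swap 3 4, by rw [Equiv.Perm.mem_alternatingGroup]; decide⟩
/-- Image of `b`. -/
def B0 : alternatingGroup (Fin 5) :=
  ⟨Equiv.swap 0 1 * Equiv.swap 2 4, by rw [Equiv.Perm.mem_alternatingGroup]; decide⟩
/-- Image of `c`. -/
def C0 : alternatingGroup (Fin 5) :=
  ⟨finRotate 5, by rw [Equiv.Perm.mem_alternatingGroup]; decide⟩

theorem C0_pow : C0 ^ 5 = 1 := by decide +kernel

theorem C0_zpow (i : ℤ) : ∃ k : Fin 5, C0 ^ i = C0 ^ (k : ℕ) := by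
  rcases zpow_cases C0_pow i with e | e | e | e | e <;> rw [e]
  · exact ⟨0, by simp⟩
  · exact ⟨1, by simp⟩
  · exact ⟨2, rfl⟩
  · exact ⟨3, rfl⟩
  · exact ⟨4, by decide +kernel⟩

theorem nf_ne1 : ∀ i j : Fin 5, C0 ^ (i : ℕ) * A0 * C0 ^ (j : ℕ) ≠ 1 := by decide +kernel
theorem nf_ne2 : ∀ i j : Fin 5, C0 ^ (i : ℕ) * (A0 * C0 ^ 2 * A0) * C0 ^ (j : ℕ) ≠ 1 := by
  decide +kernel
theorem nf_ne3 : ∀ i : Fin 5, C0 ^ (i : ℕ) * (A0 * C0 ^ 2 * A0 * C0 ^ 3 * A0) ≠ 1 := by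
  decide +kernel
theorem C0_ne : C0 ≠ 1 ∧ C0 ^ 2 ≠ 1 ∧ C0 ^ 3 ≠ 1 ∧ C0⁻¹ ≠ 1 := by decide +kernel

/-- A homomorphism sending `a, c` to `A0, C0` is injective on `⟨a, c⟩`. -/
theorem ker_closure {G : Type*} [Group G] {a c : G} (ha : a * a = 1) (hc : c ^ 5 = 1)
    (hca : (c * a) ^ 3 = 1) (f : G →* alternatingGroup (Fin 5)) (fa : f a = A0) (fc : f c = C0)
    {h : G} (hh : h ∈ Subgroup.closure {a, c}) (h1 : f h = 1) : h = 1 := by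
  rcases NF.of_mem ha hc hca hh with ⟨i, rfl⟩ | ⟨i, j, rfl⟩ | ⟨i, j, rfl⟩ | ⟨i, rfl⟩
  · rcases zpow_cases hc i with e | e | e | e | e <;> rw [e] at h1 ⊢ <;>
      simp only [map_pow, map_inv, fc] at h1
    · exact absurd h1 C0_ne.1
    · exact absurd h1 C0_ne.2.1
    · exact absurd h1 C0_ne.2.2.1
    · exact absurd h1 C0_ne.2.2.2
  · exfalso
    obtain ⟨k, hk⟩ := C0_zpow i
    obtain ⟨l, hl⟩ := C0_zpow j
    simp only [map_mul, map_zpow, map_pow, fa, fc, hk, hl] at h1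
    exact nf_ne1 k l h1
  · exfalso
    obtain ⟨k, hk⟩ := C0_zpow i
    obtain ⟨l, hl⟩ := C0_zpow j
    simp only [map_mul, map_zpow, map_pow, fa, fc, hk, hl] at h1
    exact nf_ne2 k l h1
  · exfalso
    obtain ⟨k, hk⟩ := C0_zpow i
    simp only [map_mul, map_zpow, map_pow, fa, fc, hk] at h1
    exact nf_ne3 k h1

theorem lin : ∀ v0 v1 v2 v3 v4 v5 : ZMod 2,
    v0 + v2 + v3 + v5 + v1 = 0 → v0 + v3 + v4 + v1 + v2 = 0 → v0 + v4 + v5 + v2 + v3 = 0 →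
    v0 + v5 + v1 + v3 + v4 = 0 → v0 + v1 + v2 + v4 + v5 = 0 → v0 = 0 := by decide

/-- The linear algebra on the six cosets of the dihedral group `⟨B0, C0⟩`. -/
theorem y_one (y : alternatingGroup (Fin 5) → ZMod 2)
    (hB : ∀ g, y g + y (g * B0) = 0) (hBC : ∀ g, y g + y (g * B0 * C0) = 0)
    (hAB : ∀ g, y (g * A0) + y (g * A0 * B0 * A0) + y (g * A0 * B0 * A0 * B0 * A0)
      + y (g * A0 * B0 * A0 * B0 * A0 * B0 * A0)
      + y (g * A0 * B0 * A0 * B0 * A0 * B0 * A0 * B0 * A0) = 0) : y 1 = 0 := by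
  have e2 : ∀ u v : ZMod 2, u + v = 0 → v = u := by decide
  have iB : ∀ g, y (g * B0) = y g := fun g => e2 _ _ (hB g)
  have iC : ∀ g, y (g * C0) = y g := fun g => by
    have h1 := e2 _ _ (hBC (g * B0))
    have h2 : g * B0 * B0 = g := by
      rw [mul_assoc, show B0 * B0 = 1 by decide +kernel, mul_one]
    rw [h2] at h1
    rw [h1, iB]
  have iCn : ∀ (n : ℕ) g, y (g * C0 ^ n) = y g := fun n => by
    induction n with
    | zero => simp
    | succ n ih => intro g; rw [pow_succ, ← mul_assoc, iC, ih]
  have k0 : ∀ {g r : alternatingGroup (Fin 5)} (n : ℕ), g = r * C0 ^ n → y g = y r := by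
    rintro g r n rfl; exact iCn n r
  have k1 : ∀ {g r : alternatingGroup (Fin 5)} (n : ℕ), g = r * B0 * C0 ^ n → y g = y r := by
    rintro g r n rfl; rw [iCn, iB]
  have key : ∀ g {u1 u2 u3 u4 u5 : ZMod 2}, y (g * A0) = u1 → y (g * A0 * B0 * A0) = u2 →
      y (g * A0 * B0 * A0 * B0 * A0) = u3 → y (g * A0 * B0 * A0 * B0 * A0 * B0 * A0) = u4 →
      y (g * A0 * B0 * A0 * B0 * A0 * B0 * A0 * B0 * A0) = u5 → u1 + u2 + u3 + u4 + u5 = 0 := by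
    rintro g _ _ _ _ _ rfl rfl rfl rfl rfl
    exact hAB g
  have r0 := key (C0 ^ 0 * A0)
    (k0 (r := 1) 0 (by decide +kernel))
    (k1 (r := C0 ^ 1 * A0) 1 (by decide +kernel))
    (k0 (r := C0 ^ 2 * A0) 1 (by decide +kernel))
    (k0 (r := C0 ^ 4 * A0) 3 (by decide +kernel))
    (k1 (r := C0 ^ 0 * A0) 0 (by decide +kernel))
  have r1 := key (C0 ^ 1 * A0)
    (k0 (r := 1) 1 (by decide +kernel))
    (k1 (r := C0 ^ 2 * A0) 1 (by decide +kernel))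
    (k0 (r := C0 ^ 3 * A0) 1 (by decide +kernel))
    (k0 (r := C0 ^ 0 * A0) 3 (by decide +kernel))
    (k1 (r := C0 ^ 1 * A0) 0 (by decide +kernel))
  have r2 := key (C0 ^ 2 * A0)
    (k0 (r := 1) 2 (by decide +kernel))
    (k1 (r := C0 ^ 3 * A0) 1 (by decide +kernel))
    (k0 (r := C0 ^ 4 * A0) 1 (by decide +kernel))
    (k0 (r := C0 ^ 1 * A0) 3 (by decide +kernel))
    (k1 (r := C0 ^ 2 * A0) 0 (by decide +kernel))
  have r3 := key (C0 ^ 3 * A0)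
    (k0 (r := 1) 3 (by decide +kernel))
    (k1 (r := C0 ^ 4 * A0) 1 (by decide +kernel))
    (k0 (r := C0 ^ 0 * A0) 1 (by decide +kernel))
    (k0 (r := C0 ^ 2 * A0) 3 (by decide +kernel))
    (k1 (r := C0 ^ 3 * A0) 0 (by decide +kernel))
  have r4 := key (C0 ^ 4 * A0)
    (k0 (r := 1) 4 (by decide +kernel))
    (k1 (r := C0 ^ 0 * A0) 1 (by decide +kernel))
    (k0 (r := C0 ^ 1 * A0) 1 (by decide +kernel))
    (k0 (r := C0 ^ 3 * A0) 3 (by decide +kernel))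
    (k1 (r := C0 ^ 4 * A0) 0 (by decide +kernel))
  generalize y 1 = v0 at *
  generalize y (C0 ^ 0 * A0) = v1 at *
  generalize y (C0 ^ 1 * A0) = v2 at *
  generalize y (C0 ^ 2 * A0) = v3 at *
  generalize y (C0 ^ 3 * A0) = v4 at *
  generalize y (C0 ^ 4 * A0) = v5 at *
  exact lin _ _ _ _ _ _ r0 r1 r2 r3 r4

/-- The main argument: a splitting `⟨a, c⟩` of `φ`, and the resulting cocycle `Y`. -/
theorem aux {G : Type*} [Group G] (a b c : G) (φ : G →* alternatingGroup (Fin 5))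
    (hsurj : Function.Surjective φ) (fa : φ a = A0) (fb : φ b = B0) (fc : φ c = C0)
    (ra : a * a = 1) (rb : b ^ 2 = 1) (rc : c ^ 5 = 1) (rbc : (b * c) ^ 2 = 1)
    (rca : (c * a) ^ 3 = 1) (rab : (a * b) ^ 5 = 1)
    (gen : Subgroup.closure {a, b, c} = ⊤) (ψ : φ.ker →* Multiplicative (ZMod 2)) : ψ = 1 := by
  set H : Subgroup G := Subgroup.closure {a, c} with hH
  have haH : a ∈ H := Subgroup.subset_closure (by simp)
  have hcH : c ∈ H := Subgroup.subset_closure (by simp)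
  have hinj : Function.Injective (φ.comp H.subtype) := by
    rw [injective_iff_map_eq_one]
    rintro ⟨h, hh⟩ h1
    exact Subtype.ext (ker_closure ra rc rca φ fa fc hh h1)
  have hmap : H.map φ = ⊤ := by
    have h1 : (⊤ : Subgroup G) ≤ (H.map φ).comap φ := by
      rw [← gen, Subgroup.closure_le]
      rintro x (rfl | rfl | rfl)
      · exact ⟨_, haH, rfl⟩
      · refine ⟨c ^ 4 * (a * c ^ 2 * a * c ^ 3 * a), ?_, ?_⟩
        · exact H.mul_mem (H.pow_mem hcH _) (H.mul_mem (H.mul_mem (H.mul_mem (H.mul_mem haH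
            (H.pow_mem hcH _)) haH) (H.pow_mem hcH _)) haH)
        · simp only [map_mul, map_pow, fa, fb, fc]
          decide +kernel
      · exact ⟨_, hcH, rfl⟩
    rw [eq_top_iff]
    intro g _
    obtain ⟨x, rfl⟩ := hsurj g
    exact h1 (Subgroup.mem_top x)
  have hsur : Function.Surjective (φ.comp H.subtype) := by
    intro g
    have : g ∈ H.map φ := by rw [hmap]; trivial
    obtain ⟨h, hh, e⟩ := this
    exact ⟨⟨h, hh⟩, e⟩
  let E := MulEquiv.ofBijective (φ.comp H.subtype) ⟨hinj, hsur⟩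
  let σ : alternatingGroup (Fin 5) →* G := H.subtype.comp E.symm.toMonoidHom
  have hφσ : ∀ g, φ (σ g) = g := fun g => E.apply_symm_apply g
  have hσφ : ∀ h ∈ H, σ (φ h) = h := fun h hh =>
    congrArg Subtype.val (E.symm_apply_apply ⟨h, hh⟩)
  have hker : ∀ g x, σ g * (x * (σ (φ x))⁻¹) * (σ g)⁻¹ ∈ φ.ker := fun g x => by
    rw [MonoidHom.mem_ker]; simp [hφσ]
  let Y : alternatingGroup (Fin 5) → G → ZMod 2 := fun g x =>
    Multiplicative.toAdd (ψ ⟨_, hker g x⟩)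
  have Ymul : ∀ g x x', Y g (x * x') = Y g x + Y (g * φ x) x' := by
    intro g x x'
    simp only [Y]
    rw [← toAdd_mul, ← map_mul]
    congr 2
    apply Subtype.ext
    simp only [Subgroup.coe_mul, map_mul]
    group
  have YH : ∀ g, ∀ h ∈ H, Y g h = 0 := by
    intro g h hh
    have : (⟨_, hker g h⟩ : φ.ker) = 1 := by
      apply Subtype.ext
      simp [hσφ h hh]
    simp only [Y]
    rw [this, map_one, toAdd_one]
  have Ya : ∀ g, Y g a = 0 := fun g => YH g a haH
  have Yc : ∀ g, Y g c = 0 := fun g => YH g c hcH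
  have Y1 : ∀ g, Y g 1 = 0 := fun g => YH g 1 H.one_mem
  have hB : ∀ g, Y g b + Y (g * B0) b = 0 := fun g => by
    have := Y1 g
    rw [← rb, pow_two, Ymul, fb] at this
    exact this
  have hBC : ∀ g, Y g b + Y (g * B0 * C0) b = 0 := fun g => by
    have := Y1 g
    rw [← rbc] at this
    simpa only [pow_succ, pow_zero, one_mul, Ymul, map_mul, fb, fc, Yc, add_zero, zero_add,
      mul_assoc] using this
  have hAB : ∀ g, Y (g * A0) b + Y (g * A0 * B0 * A0) b + Y (g * A0 * B0 * A0 * B0 * A0) b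
      + Y (g * A0 * B0 * A0 * B0 * A0 * B0 * A0) b
      + Y (g * A0 * B0 * A0 * B0 * A0 * B0 * A0 * B0 * A0) b = 0 := fun g => by
    have := Y1 g
    rw [← rab] at this
    simpa only [pow_succ, pow_zero, one_mul, Ymul, map_mul, fa, fb, Ya, add_zero, zero_add,
      mul_assoc, add_assoc] using this
  have Yb : ∀ g, Y g b = 0 := fun g => by
    have := y_one (fun h => Y (g * h) b) (fun h => by simpa only [mul_assoc] using hB (g * h))
      (fun h => by simpa only [mul_assoc] using hBC (g * h))
      (fun h => by simpa only [mul_assoc] using hAB (g * h))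
    simpa only [mul_one] using this
  have Yinv : ∀ x, (∀ g, Y g x = 0) → ∀ g, Y g x⁻¹ = 0 := fun x hx g => by
    have := Ymul g x⁻¹ x
    rw [hx, inv_mul_cancel, Y1, add_zero] at this
    exact this.symm
  have Yall : ∀ x, ∀ g, Y g x = 0 := by
    intro x
    have hx : x ∈ Subgroup.closure {a, b, c} := by rw [gen]; trivial
    induction hx using Subgroup.closure_induction with
    | mem x hx =>
      rcases hx with rfl | rfl | rfl
      · exact Ya
      · exact Yb
      · exact Yc
    | one => exact Y1
    | mul x y _ _ hx hy => intro g; rw [Ymul, hx, hy, add_zero]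
    | inv x _ hx => exact Yinv x hx
  ext ⟨k, hk⟩
  have h := Yall k 1
  have : (⟨_, hker 1 k⟩ : φ.ker) = ⟨k, hk⟩ := by
    apply Subtype.ext
    simp [MonoidHom.mem_ker.mp hk]
  simp only [Y] at h
  rw [this] at h
  exact h

/-- Let `φ : Γ⁺ → A₅` be the surjective homomorphism with `φ(a) = (2 3)(4 5)`,
`φ(b) = (1 2)(3 5)`, `φ(c) = (1 2 3 4 5)` and let `K = ker φ` (the fundamental
group of the Seifert–Weber dodecahedral space `SW`). Then every homomorphism
from `K` to `ℤ/2ℤ` is trivial (i.e. `H₁(SW; ℤ/2ℤ) = 0`). -/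
theorem hom_ker_to_zmod2_trivial (φ : GammaPlus →* alternatingGroup (Fin 5))
    (hsurj : Function.Surjective φ)
    (ha : (φ (PresentedGroup.of Gen.a) : Equiv.Perm (Fin 5)) = Equiv.swap 1 2 * Equiv.swap 3 4)
    (hb : (φ (PresentedGroup.of Gen.b) : Equiv.Perm (Fin 5)) = Equiv.swap 0 1 * Equiv.swap 2 4)
    (hc : (φ (PresentedGroup.of Gen.c) : Equiv.Perm (Fin 5)) = finRotate 5) :
    ∀ ψ : φ.ker →* Multiplicative (ZMod 2), ψ = 1 := by
  intro ψ
  have fa : φ (PresentedGroup.of Gen.a) = A0 := Subtype.ext ha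
  have fb : φ (PresentedGroup.of Gen.b) = B0 := Subtype.ext hb
  have fc : φ (PresentedGroup.of Gen.c) = C0 := Subtype.ext hc
  clear ha hb hc
  -- relations
  have rel : ∀ r ∈ rels, (PresentedGroup.mk rels r : GammaPlus) = 1 := fun r hr =>
    PresentedGroup.one_of_mem hr
  have ra := rel (FreeGroup.of Gen.a ^ 2) (by simp [rels])
  have rb := rel (FreeGroup.of Gen.b ^ 2) (by simp [rels])
  have rc := rel (FreeGroup.of Gen.c ^ 5) (by simp [rels])
  have rbc := rel ((FreeGroup.of Gen.b * FreeGroup.of Gen.c) ^ 2) (by simp [rels])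
  have rca := rel ((FreeGroup.of Gen.c * FreeGroup.of Gen.a) ^ 3) (by simp [rels])
  have rab := rel ((FreeGroup.of Gen.a * FreeGroup.of Gen.b) ^ 5) (by simp [rels])
  simp only [map_pow, map_mul] at ra rb rc rbc rca rab
  have gen : Subgroup.closure (Set.range (PresentedGroup.of (rels := rels))) = ⊤ :=
    PresentedGroup.closure_range_of rels
  change (PresentedGroup.of Gen.a : GammaPlus) ^ 2 = 1 at ra
  change (PresentedGroup.of Gen.b : GammaPlus) ^ 2 = 1 at rb
  change (PresentedGroup.of Gen.c : GammaPlus) ^ 5 = 1 at rc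
  change (PresentedGroup.of Gen.b * PresentedGroup.of Gen.c : GammaPlus) ^ 2 = 1 at rbc
  change (PresentedGroup.of Gen.c * PresentedGroup.of Gen.a : GammaPlus) ^ 3 = 1 at rca
  change (PresentedGroup.of Gen.a * PresentedGroup.of Gen.b : GammaPlus) ^ 5 = 1 at rab
  have gen' : Subgroup.closure {(PresentedGroup.of Gen.a : GammaPlus), PresentedGroup.of Gen.b,
      PresentedGroup.of Gen.c} = ⊤ := by
    rw [eq_top_iff, ← gen]
    apply Subgroup.closure_mono
    rintro _ ⟨x, rfl⟩
    cases x <;> simp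
  exact aux _ _ _ φ hsurj fa fb fc (by rw [← pow_two]; exact ra) rb rc rbc rca rab gen' ψ
end

section
/- The group Γ⁺ contains exactly 4 conjugacy classes of elements of order 5. -/
set_option linter.unusedSimpArgs false
set_option linter.unnecessarySeqFocus false


section A5
variable {G : Type*} [Group G]

/-- words forms -/
theorem a5_rules {x y : G} (hx : x ^ 5 = 1) (hy : y ^ 2 = 1) (hxy : (x * y) ^ 3 = 1) :
    (y * y = 1) ∧ (x * (x * (x * (x * x))) = 1) ∧
    (y * (x * y) = x * (x * (x * (x * (y * (x * (x * (x * x)))))))) ∧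
    (y * (x * (x * (x * (x * y)))) = x * (y * x)) ∧
    (y * (x * (x * (x * y))) = x * (y * (x * (x * (y * x))))) ∧
    (y * (x * (x * (y * (x * (x * y))))) =
      x * (x * (x * (x * (y * (x * (x * (y * (x * (x * (x * x))))))))))) ∧
    (y * (x * (x * (y * (x * (x * (x * (y * x))))))) =
      x * (x * (x * (x * (y * (x * (x * (y * (x * (x * (x * y))))))))))) := by
  have h1 : y * y = 1 := by rw [← sq, hy]
  have h2 : x * (x * (x * (x * x))) = 1 := by rw [← hx]; simp only [pow_succ, pow_zero, one_mul, mul_assoc]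
  have h1' : ∀ t, y * (y * t) = t := fun t => by rw [← mul_assoc, h1, one_mul]
  have h2' : ∀ t, x * (x * (x * (x * (x * t)))) = t := fun t => by
    have := congrArg (· * t) h2
    simpa only [mul_assoc, one_mul] using this
  have h0 : x * (y * (x * (y * (x * y)))) = 1 := by
    rw [← hxy]; simp only [pow_succ, pow_zero, one_mul, mul_assoc]
  have h3 : y * (x * y) = x * (x * (x * (x * (y * (x * (x * (x * x))))))) := by
    have e : y * (x * y) * (x * (y * x)) = 1 := by
      have h0' : y * (x * (y * (x * (y * x)))) = 1 := by
        have := congrArg (fun t => x * x * x * x * t * x) h0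
        simpa only [mul_assoc, h1, h2, h2', mul_one, one_mul] using this
      simpa only [mul_assoc] using h0'
    have e2 := eq_inv_of_mul_eq_one_left e
    rw [e2]
    symm
    apply eq_inv_of_mul_eq_one_left
    simp only [mul_assoc, h1, h2, h2', h1', mul_one]
  have h3' : ∀ t, y * (x * (y * t)) = x * (x * (x * (x * (y * (x * (x * (x * (x * t)))))))) := fun t => by
    have := congrArg (· * t) h3
    simpa only [mul_assoc, one_mul] using this
  have h4 : y * (x * (x * (x * (x * y)))) = x * (y * x) := by
    have e : (y * (x * (x * (x * (x * y))))) * (y * (x * y)) = (x * (y * x)) * (y * (x * y)) := by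
      have e1 : (x * (y * x)) * (y * (x * y)) = 1 := by simpa only [mul_assoc] using h0
      rw [e1]
      simp only [mul_assoc, h1, h2', h1']
    exact mul_right_cancel e
  have h4' : ∀ t, y * (x * (x * (x * (x * (y * t))))) = x * (y * (x * t)) := fun t => by
    have := congrArg (· * t) h4
    simpa only [mul_assoc, one_mul] using this
  have h5 : y * (x * (x * (x * y))) = x * (y * (x * (x * (y * x)))) := by
    have e : (y * (x * (x * (x * (x * y))))) * (y * (x * (x * (x * (x * y))))) = x * (y * x) * (x * (y * x)) := by
      rw [h4]
    simpa only [mul_assoc, h1, h2, h2', h1', mul_one] using e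
  have h5' : ∀ t, y * (x * (x * (x * (y * t)))) = x * (y * (x * (x * (y * (x * t))))) := fun t => by
    have := congrArg (· * t) h5
    simpa only [mul_assoc, one_mul] using this
  refine ⟨h1, h2, h3, h4, h5, ?_, ?_⟩
  · have e : y * (x * (x * (y * (x * (x * y))))) =
      y * (x * (x * ((x * x * x * x) * (y * (x * (x * (x * y)))) * (x * x * x * x)))) := by
      rw [h5]; simp only [mul_assoc, h1, h2, h2', h1', mul_one]
    rw [e]
    simp only [mul_assoc, h1, h2, h2', h1', mul_one, h3, h3']
  · have e : y * (x * (x * (y * (x * (x * (x * y)))))) = y * (x * (x * (x * (y * (x * (x * (y * x))))))) := by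
      rw [h5]
    rw [h5'] at e
    have := congrArg (fun t => x * x * x * x * t) e
    simp only [mul_assoc, h2'] at this
    rw [this]

theorem a5_conj {x y : G} (hx : x ^ 5 = 1) (hy : y ^ 2 = 1) (hxy : (x * y) ^ 3 = 1)
    (g : G) (hg : g ∈ Subgroup.closure {x, y}) (hg5 : g ^ 5 = 1) :
    ∃ r : G, ∃ k < 5, g = r⁻¹ * x ^ k * r := by
  obtain ⟨h1, h2, h3, h4, h5, h6, h7⟩ := a5_rules hx hy hxy
  have tail : ∀ {u v : G}, u = v → ∀ t, u * t = v * t := fun h t => by rw [h]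
  have h1' := tail h1
  have h2' := tail h2
  have h3' := tail h3
  have h4' := tail h4
  have h5' := tail h5
  have h6' := tail h6
  have h7' := tail h7
  simp only [mul_assoc, one_mul] at h1' h2' h3' h4' h5' h6' h7'
  have hpow : ∀ n : ℕ, x ^ n = x ^ (n % 5) := fun n => by
    conv_lhs => rw [← Nat.div_add_mod n 5, pow_add, pow_mul, hx, one_pow, one_mul]
  have hc : ∃ k j : ℕ, (g = x ^ k ∨ g = x ^ k * (y * x ^ j) ∨
      g = x ^ k * (y * (x * (x * (y * x ^ j)))) ∨
      g = x ^ k * (y * (x * (x * (y * (x * (x * (x * y)))))))) := by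
    clear hg5
    have stepx : ∀ g : G, (∃ k j : ℕ, (g = x ^ k ∨ g = x ^ k * (y * x ^ j) ∨
        g = x ^ k * (y * (x * (x * (y * x ^ j)))) ∨
        g = x ^ k * (y * (x * (x * (y * (x * (x * (x * y))))))))) →
        (∃ k j : ℕ, (g * x = x ^ k ∨ g * x = x ^ k * (y * x ^ j) ∨
        g * x = x ^ k * (y * (x * (x * (y * x ^ j)))) ∨
        g * x = x ^ k * (y * (x * (x * (y * (x * (x * (x * y))))))))) := by
      rintro g ⟨k, j, rfl | rfl | rfl | rfl⟩
      · exact ⟨k + 1, 0, Or.inl (by rw [pow_succ])⟩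
      · exact ⟨k, j + 1, Or.inr (Or.inl (by simp only [pow_succ, mul_assoc]))⟩
      · exact ⟨k, j + 1, Or.inr (Or.inr (Or.inl (by simp only [pow_succ, mul_assoc])))⟩
      · exact ⟨k + 4, 0, Or.inr (Or.inr (Or.inr (by simp only [pow_succ, mul_assoc, h7])))⟩
    have stepy : ∀ g : G, (∃ k j : ℕ, (g = x ^ k ∨ g = x ^ k * (y * x ^ j) ∨
        g = x ^ k * (y * (x * (x * (y * x ^ j)))) ∨
        g = x ^ k * (y * (x * (x * (y * (x * (x * (x * y))))))))) →
        (∃ k j : ℕ, (g * y = x ^ k ∨ g * y = x ^ k * (y * x ^ j) ∨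
        g * y = x ^ k * (y * (x * (x * (y * x ^ j)))) ∨
        g * y = x ^ k * (y * (x * (x * (y * (x * (x * (x * y))))))))) := by
      rintro g ⟨k, j, rfl | rfl | rfl | rfl⟩
      · exact ⟨k, 0, Or.inr (Or.inl (by simp))⟩
      · rw [hpow j]
        have : j % 5 < 5 := Nat.mod_lt _ (by norm_num)
        interval_cases j % 5
        · exact ⟨k, 0, Or.inl (by simp [mul_assoc, h1])⟩
        · exact ⟨k + 4, 4, Or.inr (Or.inl (by
            simp only [pow_succ, pow_zero, one_mul, mul_assoc, h3]))⟩
        · exact ⟨k, 0, Or.inr (Or.inr (Or.inl (by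
            simp only [pow_succ, pow_zero, one_mul, mul_one, mul_assoc])))⟩
        · exact ⟨k + 1, 1, Or.inr (Or.inr (Or.inl (by
            simp only [pow_succ, pow_zero, one_mul, mul_one, mul_assoc, h5])))⟩
        · exact ⟨k + 1, 1, Or.inr (Or.inl (by
            simp only [pow_succ, pow_zero, one_mul, mul_assoc, h4]))⟩
      · rw [hpow j]
        have : j % 5 < 5 := Nat.mod_lt _ (by norm_num)
        interval_cases j % 5
        · exact ⟨k, 2, Or.inr (Or.inl (by
            simp only [pow_succ, pow_zero, one_mul, mul_one, mul_assoc, h1]))⟩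
        · exact ⟨k + 4, 3, Or.inr (Or.inl (by
            simp only [pow_succ, pow_zero, one_mul, mul_one, mul_assoc, h3, h2', h3']))⟩
        · exact ⟨k + 4, 4, Or.inr (Or.inr (Or.inl (by
            simp only [pow_succ, pow_zero, one_mul, mul_one, mul_assoc, h6])))⟩
        · exact ⟨k, 0, Or.inr (Or.inr (Or.inr (by
            simp only [pow_succ, pow_zero, one_mul, mul_one, mul_assoc])))⟩
        · exact ⟨k + 1, 2, Or.inr (Or.inr (Or.inl (by
            simp only [pow_succ, pow_zero, one_mul, mul_one, mul_assoc, h4, h5'])))⟩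
      · exact ⟨k, 3, Or.inr (Or.inr (Or.inl (by
            simp only [pow_succ, pow_zero, one_mul, mul_one, mul_assoc, h1])))⟩
    have hxi : x⁻¹ = x * x * x * x := by
      rw [inv_eq_iff_mul_eq_one]; simpa only [mul_assoc] using h2
    have hyi : y⁻¹ = y := by
      rw [inv_eq_iff_mul_eq_one]; exact h1
    induction hg using Subgroup.closure_induction_right with
    | one => exact ⟨0, 0, Or.inl (by simp)⟩
    | mul_right g hg z hz ih =>
      rcases hz with rfl | rfl
      · exact stepx g ih
      · exact stepy g ih
    | mul_inv_cancel g hg z hz ih =>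
      rcases hz with rfl | rfl
      · rw [hxi]
        have e : g * (z * z * z * z) = g * z * z * z * z := by simp only [mul_assoc]
        rw [e]
        exact stepx _ (stepx _ (stepx _ (stepx _ ih)))
      · rw [hyi]
        exact stepy g ih
  -- reduce to a normal form up to conjugation by powers of `x`
  have hred : ∃ h r : G, g = r⁻¹ * h * r ∧ ∃ k < 5, (h = x ^ k ∨ h = x ^ k * y ∨
      h = x ^ k * (y * (x * (x * y))) ∨
      h = x ^ k * (y * (x * (x * (y * (x * (x * (x * y)))))))) := by
    obtain ⟨k, j, hk⟩ := hc
    have lt : ∀ n, n % 5 < 5 := fun n => Nat.mod_lt _ (by norm_num)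
    rcases hk with hk | hk | hk | hk
    · exact ⟨g, 1, by group, k % 5, lt _, Or.inl (by rw [hk, hpow])⟩
    · refine ⟨x ^ (j + k) * y, x ^ j, ?_, (j + k) % 5, lt _, Or.inr (Or.inl (by rw [← hpow]))⟩
      rw [hk, pow_add]; group
    · refine ⟨x ^ (j + k) * (y * (x * (x * y))), x ^ j, ?_, (j + k) % 5, lt _,
        Or.inr (Or.inr (Or.inl (by rw [← hpow])))⟩
      rw [hk, pow_add]; group
    · exact ⟨g, 1, by group, k % 5, lt _, Or.inr (Or.inr (Or.inr (by rw [hk, hpow k])))⟩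
  obtain ⟨h, r, rfl, hk⟩ := hred
  have hh5 : h ^ 5 = 1 := by
    have e : (r⁻¹ * h * r) ^ 5 = r⁻¹ * h ^ 5 * r := by
      have := conj_pow (i := 5) (a := r⁻¹) (b := h)
      simpa using this
    rw [e] at hg5
    have := congrArg (fun t => r * t * r⁻¹) hg5
    simpa [mul_assoc] using this
  have key : ∃ q : G, ∃ k < 5, q * h = x ^ k * q := by
    have two : h * h = 1 → ∃ q : G, ∃ k < 5, q * h = x ^ k * q := fun e => by
      have : h = 1 := by
        calc h = (h * h) * (h * h) * h := by rw [e]; simp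
          _ = h ^ 5 := by simp only [pow_succ, pow_zero, one_mul, mul_assoc]
          _ = 1 := hh5
      exact ⟨1, 0, by norm_num, by simp [this]⟩
    have three : h * (h * h) = 1 → ∃ q : G, ∃ k < 5, q * h = x ^ k * q := fun e => by
      have e2 : h * h = 1 := by
        calc h * h = (h * (h * h)) * (h * h) := by rw [e]; simp
          _ = h ^ 5 := by simp only [pow_succ, pow_zero, one_mul, mul_assoc]
          _ = 1 := hh5
      exact two e2
    clear hg5 hc hpow
    obtain ⟨k, hk, rfl | rfl | rfl | rfl⟩ := hk
    · exact ⟨1, k, hk, by simp⟩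
    · interval_cases k
      · apply two; simp [h1]
      · apply three
        simp only [pow_succ, pow_zero, one_mul, mul_one, mul_assoc, h1, h2, h3, h4, h5, h6, h7, h1', h2', h3', h4', h5', h6', h7']
      · refine ⟨y * (x * y), 4, by norm_num, ?_⟩
        simp only [pow_succ, pow_zero, one_mul, mul_one, mul_assoc, h1, h2, h3, h4, h5, h6, h7, h1', h2', h3', h4', h5', h6', h7']
      · refine ⟨y * x, 1, by norm_num, ?_⟩
        simp only [pow_succ, pow_zero, one_mul, mul_one, mul_assoc, h1, h2, h3, h4, h5, h6, h7, h1', h2', h3', h4', h5', h6', h7']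
      · apply three
        simp only [pow_succ, pow_zero, one_mul, mul_one, mul_assoc, h1, h2, h3, h4, h5, h6, h7, h1', h2', h3', h4', h5', h6', h7']
    · interval_cases k
      · refine ⟨y, 2, by norm_num, ?_⟩
        simp only [pow_succ, pow_zero, one_mul, mul_one, mul_assoc, h1, h2, h3, h4, h5, h6, h7, h1', h2', h3', h4', h5', h6', h7']
      · apply two
        simp only [pow_succ, pow_zero, one_mul, mul_one, mul_assoc, h1, h2, h3, h4, h5, h6, h7, h1', h2', h3', h4', h5', h6', h7']
      · refine ⟨y * (x * y), 3, by norm_num, ?_⟩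
        simp only [pow_succ, pow_zero, one_mul, mul_one, mul_assoc, h1, h2, h3, h4, h5, h6, h7, h1', h2', h3', h4', h5', h6', h7']
      · apply three
        simp only [pow_succ, pow_zero, one_mul, mul_one, mul_assoc, h1, h2, h3, h4, h6, h7, h1', h2', h3', h4', h6', h7']
      · apply three
        simp only [pow_succ, pow_zero, one_mul, mul_one, mul_assoc, h1, h2, h3, h4, h5, h6, h7, h1', h2', h3', h4', h5', h6', h7']
    · apply two
      interval_cases k <;>
        simp only [pow_succ, pow_zero, one_mul, mul_one, mul_assoc, h1, h2, h3, h4, h6, h7, h1', h2', h3', h4', h6', h7']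
  obtain ⟨q, k, hk, e⟩ := key
  refine ⟨q * r, k, hk, ?_⟩
  have : h = q⁻¹ * (x ^ k * q) := by rw [← e]; group
  rw [this]; group

theorem dihedral_conj {x y : G} (hx : x ^ 5 = 1) (hy : y ^ 2 = 1) (hxy : (x * y) ^ 2 = 1)
    (g : G) (hg : g ∈ Subgroup.closure {x, y}) (hg5 : g ^ 5 = 1) :
    ∃ r : G, ∃ k < 5, g = r⁻¹ * x ^ k * r := by
  have hy' : y * y = 1 := by rw [← sq, hy]
  have hyi : y⁻¹ = y := by
    rw [inv_eq_iff_mul_eq_one]; exact hy'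
  have hconj : y * x * y⁻¹ = x⁻¹ := by
    rw [hyi, eq_comm, inv_eq_iff_mul_eq_one, ← hxy, sq]; simp only [mul_assoc]
  have hyx : ∀ k : ℤ, y * x ^ k = x ^ (-k) * y := fun k => by
    have : (y * x * y⁻¹) ^ k = y * x ^ k * y⁻¹ := conj_zpow
    rw [hconj, inv_zpow'] at this
    rw [this]; simp
  have hc : ∃ k : ℤ, g = x ^ k ∨ g = x ^ k * y := by
    clear hg5
    induction hg using Subgroup.closure_induction_right with
    | one => exact ⟨0, Or.inl (by simp)⟩
    | mul_right g hg z hz ih =>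
      obtain ⟨k, rfl | rfl⟩ := ih <;> rcases hz with rfl | rfl
      · exact ⟨k + 1, Or.inl (by rw [zpow_add_one])⟩
      · exact ⟨k, Or.inr rfl⟩
      · refine ⟨k - 1, Or.inr ?_⟩
        have := hyx 1
        rw [zpow_one] at this
        rw [mul_assoc, this, ← mul_assoc, ← zpow_add, sub_eq_add_neg]
      · exact ⟨k, Or.inl (by rw [mul_assoc, hy', mul_one])⟩
    | mul_inv_cancel g hg z hz ih =>
      obtain ⟨k, rfl | rfl⟩ := ih <;> rcases hz with rfl | rfl
      · exact ⟨k - 1, Or.inl (by rw [zpow_sub_one])⟩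
      · exact ⟨k, Or.inr (by rw [hyi])⟩
      · refine ⟨k + 1, Or.inr ?_⟩
        have := hyx (-1)
        rw [zpow_neg_one, neg_neg] at this
        rw [mul_assoc, this, ← mul_assoc, ← zpow_add]
      · exact ⟨k, Or.inl (by simp)⟩
  obtain ⟨k, rfl | rfl⟩ := hc
  · refine ⟨1, (k % 5).toNat, by omega, ?_⟩
    have e : x ^ k = x ^ (k % 5) := by
      conv_lhs => rw [← Int.mul_ediv_add_emod k 5, zpow_add, zpow_mul]
      have : x ^ (5 : ℤ) = 1 := by exact_mod_cast hx
      rw [this, one_zpow, one_mul]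
    rw [inv_one, one_mul, mul_one, ← zpow_natCast, Int.toNat_of_nonneg (by omega), e]
  · have e : (x ^ k * y) * (x ^ k * y) = 1 := by
      rw [mul_assoc, ← mul_assoc y, hyx, mul_assoc, hy', mul_one, ← zpow_add]; simp
    have : x ^ k * y = 1 := by
      rw [pow_succ, pow_succ, pow_succ, pow_succ, pow_one, mul_assoc _ _ (x ^ k * y), e] at hg5
      simpa using hg5
    exact ⟨1, 0, by norm_num, by rw [this]; simp⟩
end A5


section Tits
open Real

/-- The four linear functionals `x ↦ B(x, α i)` of the Coxeter form with parameters `p`, `q`. -/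
def bb (p q : ℝ) (i : Fin 4) (x : Fin 4 → ℝ) : ℝ :=
  ![2 * x 0 - p * x 1, 2 * x 1 - p * x 0 - x 2, 2 * x 2 - x 1 - q * x 3, 2 * x 3 - q * x 2] i

/-- simple roots -/
def rt (i : Fin 4) : Fin 4 → ℝ := Pi.single i 1

/-- A group generated by four involutions satisfying the `[5,3,5]` Coxeter relations, together
with its geometric representation and its sign character. -/
structure TitsData (W : Type) [Group W] where
  s : Fin 4 → W
  sq : ∀ i, s i * s i = 1
  gen : Subgroup.closure (Set.range s) = ⊤
  r01 : s 0 * s 1 * s 0 * s 1 * s 0 = s 1 * s 0 * s 1 * s 0 * s 1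
  r23 : s 2 * s 3 * s 2 * s 3 * s 2 = s 3 * s 2 * s 3 * s 2 * s 3
  r12 : s 1 * s 2 * s 1 = s 2 * s 1 * s 2
  r02 : s 0 * s 2 = s 2 * s 0
  r03 : s 0 * s 3 = s 3 * s 0
  r13 : s 1 * s 3 = s 3 * s 1
  rho : W →* Module.End ℝ (Fin 4 → ℝ)
  rho_s : ∀ i x, rho (s i) x = x - bb goldenRatio goldenRatio i x • rt i
  sgn : W →* ℤˣ
  sgn_s : ∀ i, sgn (s i) = -1

namespace TitsData
variable {W : Type} [Group W] (d : TitsData W)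

theorem inv_s (i : Fin 4) : (d.s i)⁻¹ = d.s i := by
  rw [inv_eq_iff_mul_eq_one]; exact d.sq i

theorem exists_word (w : W) : ∃ L : List (Fin 4), (L.map d.s).prod = w := by
  have hw : w ∈ Subgroup.closure (Set.range d.s) := by rw [d.gen]; trivial
  induction hw using Subgroup.closure_induction_right with
  | one => exact ⟨[], rfl⟩
  | mul_right x hx y hy ih =>
    obtain ⟨L, rfl⟩ := ih
    obtain ⟨i, rfl⟩ := hy
    exact ⟨L ++ [i], by simp⟩
  | mul_inv_cancel x hx y hy ih =>
    obtain ⟨L, rfl⟩ := ih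
    obtain ⟨i, rfl⟩ := hy
    exact ⟨L ++ [i], by simp [d.inv_s]⟩

theorem exists_len (w : W) : ∃ n, ∃ L : List (Fin 4), L.length = n ∧ (L.map d.s).prod = w := by
  obtain ⟨L, h⟩ := d.exists_word w
  exact ⟨_, L, rfl, h⟩

open Classical in
/-- word length -/
noncomputable def len (w : W) : ℕ := Nat.find (d.exists_len w)

theorem exists_reduced (w : W) :
    ∃ L : List (Fin 4), L.length = d.len w ∧ (L.map d.s).prod = w := by
  classical exact Nat.find_spec (d.exists_len w)

theorem len_le (L : List (Fin 4)) : d.len (L.map d.s).prod ≤ L.length := by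
  classical exact Nat.find_min' _ ⟨L, rfl, rfl⟩

theorem len_mul_le (w : W) (i : Fin 4) : d.len (w * d.s i) ≤ d.len w + 1 := by
  obtain ⟨L, h, hw⟩ := d.exists_reduced w
  have := d.len_le (L ++ [i])
  simp [hw] at this
  omega

theorem mul_s_s (w : W) (i : Fin 4) : w * d.s i * d.s i = w := by
  rw [mul_assoc, d.sq, mul_one]

theorem sgn_eq (w : W) : d.sgn w = (-1) ^ d.len w := by
  obtain ⟨L, h, hw⟩ := d.exists_reduced w
  rw [← h]
  conv_lhs => rw [← hw]
  clear h hw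
  induction L with
  | nil => simp
  | cons i L ih => simp [ih, d.sgn_s, pow_succ]

theorem len_cases (w : W) (i : Fin 4) :
    d.len (w * d.s i) = d.len w + 1 ∨ d.len w = d.len (w * d.s i) + 1 := by
  have h1 := d.len_mul_le w i
  have h2 := d.len_mul_le (w * d.s i) i
  rw [d.mul_s_s] at h2
  have h3 : d.len (w * d.s i) ≠ d.len w := by
    intro h
    have e1 := d.sgn_eq w
    have e2 := d.sgn_eq (w * d.s i)
    rw [map_mul, d.sgn_s, h, ← e1] at e2
    simp at e2
  omega

theorem eq_one_of_len {w : W} (h : d.len w = 0) : w = 1 := by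
  obtain ⟨L, h', hw⟩ := d.exists_reduced w
  rw [h, List.length_eq_zero_iff] at h'
  rw [← hw, h']; rfl

theorem exists_descent {w : W} (h : d.len w ≠ 0) : ∃ i, d.len w = d.len (w * d.s i) + 1 := by
  obtain ⟨L, h', hw⟩ := d.exists_reduced w
  rcases List.eq_nil_or_concat L with rfl | ⟨L', i, rfl⟩
  · simp at h'; omega
  · refine ⟨i, ?_⟩
    rcases d.len_cases w i with h1 | h1
    · exfalso
      have : w * d.s i = (L'.map d.s).prod := by rw [← hw]; simp [d.mul_s_s]
      have h2 := d.len_le L'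
      rw [← this] at h2
      simp at h'
      omega
    · exact h1

theorem rho_step (w : W) (i : Fin 4) (x : Fin 4 → ℝ) :
    d.rho w x = d.rho (w * d.s i) (d.rho (d.s i) x) := by
  rw [← Module.End.mul_apply, ← map_mul, d.mul_s_s]

theorem bb_rt (p q : ℝ) (i j : Fin 4) : bb p q i (rt j) =
    !![2, -p, 0, 0; -p, 2, -1, 0; 0, -1, 2, -q; 0, 0, -q, 2] i j := by
  fin_cases i <;> fin_cases j <;> simp [bb, rt]

theorem rho_neg (i : Fin 4) : d.rho (d.s i) (rt i) = - rt i := by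
  rw [d.rho_s, bb_rt]
  fin_cases i <;> simp <;> module

/-- descent by one letter for a pair of simple roots -/
theorem pair_step (w : W) (i t : Fin 4) (x : ℝ)
    (h : d.rho (d.s t) (rt i) = rt i + x • rt t) :
    d.rho w (rt i) = d.rho (w * d.s t) (rt i) + x • d.rho (w * d.s t) (rt t) ∧
    d.rho w (rt t) = - d.rho (w * d.s t) (rt t) := by
  constructor
  · rw [d.rho_step w t, h, map_add, map_smul]
  · rw [d.rho_step w t, d.rho_neg, map_neg]

theorem dih2 (w : W) (i t : Fin 4)
    (IH : ∀ v, d.len v < d.len w → ∀ j, d.len v < d.len (v * d.s j) → 0 ≤ d.rho v (rt j))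
    (hr : d.s i * d.s t = d.s t * d.s i)
    (hit : d.rho (d.s t) (rt i) = rt i + (0 : ℝ) • rt t)
    (h1 : d.len w < d.len (w * d.s i)) (h2 : d.len w = d.len (w * d.s t) + 1) :
    0 ≤ d.rho w (rt i) := by
  obtain ⟨e1, -⟩ := d.pair_step w i t 0 hit
  rcases d.len_cases (w * d.s t) i with c | c
  · rw [e1, zero_smul, add_zero]
    exact IH _ (by omega) _ (by omega)
  · exfalso
    have e : w * d.s i = w * d.s t * d.s i * d.s t := by
      rw [mul_assoc w, ← hr, ← mul_assoc, d.mul_s_s]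
    have := d.len_mul_le (w * d.s t * d.s i) t
    rw [← e] at this
    omega

theorem dih3 (w : W) (i t : Fin 4)
    (IH : ∀ v, d.len v < d.len w → ∀ j, d.len v < d.len (v * d.s j) → 0 ≤ d.rho v (rt j))
    (hr : d.s i * d.s t * d.s i = d.s t * d.s i * d.s t)
    (hit : d.rho (d.s t) (rt i) = rt i + (1 : ℝ) • rt t)
    (hti : d.rho (d.s i) (rt t) = rt t + (1 : ℝ) • rt i)
    (h1 : d.len w < d.len (w * d.s i)) (h2 : d.len w = d.len (w * d.s t) + 1) :
    0 ≤ d.rho w (rt i) := by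
  obtain ⟨e1, -⟩ := d.pair_step w i t 1 hit
  have p1 := IH (w * d.s t) (by omega) t (by rw [d.mul_s_s]; omega)
  rcases d.len_cases (w * d.s t) i with c | c
  · rw [e1, one_smul]
    exact add_nonneg (IH _ (by omega) _ (by omega)) p1
  obtain ⟨e2, e2'⟩ := d.pair_step (w * d.s t) t i 1 hti
  rcases d.len_cases (w * d.s t * d.s i) t with c' | c'
  · have : d.rho w (rt i) = d.rho (w * d.s t * d.s i) (rt t) := by
      rw [e1, e2, e2']; module
    rw [this]
    exact IH _ (by omega) _ (by omega)
  · exfalso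
    have e : w * d.s i = w * d.s t * d.s i * d.s t * d.s i * d.s t := by
      have : w * d.s t * d.s i * d.s t * d.s i * d.s t
        = w * d.s t * d.s i * d.s t * d.s i * d.s t * d.s i * d.s i := by rw [d.mul_s_s]
      rw [this]
      have : w * d.s t * d.s i * d.s t * d.s i * d.s t * d.s i * d.s i
        = w * (d.s t * d.s i * d.s t) * (d.s i * d.s t * d.s i) * d.s i := by
        simp only [mul_assoc]
      rw [this, hr]
      simp only [← mul_assoc, d.mul_s_s]
    have u1 := d.len_mul_le (w * d.s t * d.s i * d.s t) i
    have u2 := d.len_mul_le (w * d.s t * d.s i * d.s t * d.s i) t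
    rw [← e] at u2
    omega

theorem dih5 (w : W) (i t : Fin 4)
    (IH : ∀ v, d.len v < d.len w → ∀ j, d.len v < d.len (v * d.s j) → 0 ≤ d.rho v (rt j))
    (hr : d.s i * d.s t * d.s i * d.s t * d.s i = d.s t * d.s i * d.s t * d.s i * d.s t)
    (hit : d.rho (d.s t) (rt i) = rt i + goldenRatio • rt t)
    (hti : d.rho (d.s i) (rt t) = rt t + goldenRatio • rt i)
    (h1 : d.len w < d.len (w * d.s i)) (h2 : d.len w = d.len (w * d.s t) + 1) :
    0 ≤ d.rho w (rt i) := by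
  have hg : goldenRatio * goldenRatio = goldenRatio + 1 := by rw [← _root_.sq, goldenRatio_sq]
  have hg0 : 0 ≤ goldenRatio := goldenRatio_pos.le
  set g := goldenRatio
  obtain ⟨e1, e1'⟩ := d.pair_step w i t g hit
  set v1 := w * d.s t with hv1
  have p1 := IH v1 (by omega) t (by rw [show v1 * d.s t = w from d.mul_s_s _ _]; omega)
  rcases d.len_cases v1 i with c | c
  · rw [e1]
    exact add_nonneg (IH _ (by omega) _ (by omega)) (smul_nonneg hg0 p1)
  obtain ⟨e2, e2'⟩ := d.pair_step v1 t i g hti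
  set v2 := v1 * d.s i with hv2
  have p2 := IH v2 (by omega) i (by rw [show v2 * d.s i = v1 from d.mul_s_s _ _]; omega)
  have f2 : d.rho w (rt i) = g • d.rho v2 (rt i) + g • d.rho v2 (rt t) := by
    rw [e1, e2, e2', smul_add, smul_smul, hg]; module
  rcases d.len_cases v2 t with c2 | c2
  · rw [f2]
    exact add_nonneg (smul_nonneg hg0 p2) (smul_nonneg hg0 (IH _ (by omega) _ (by omega)))
  obtain ⟨e3, e3'⟩ := d.pair_step v2 i t g hit
  set v3 := v2 * d.s t with hv3
  have p3 := IH v3 (by omega) t (by rw [show v3 * d.s t = v2 from d.mul_s_s _ _]; omega)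
  have f3 : d.rho w (rt i) = g • d.rho v3 (rt i) + d.rho v3 (rt t) := by
    rw [f2, e3, e3', smul_add, smul_smul, hg]; module
  rcases d.len_cases v3 i with c3 | c3
  · rw [f3]
    exact add_nonneg (smul_nonneg hg0 (IH _ (by omega) _ (by omega))) p3
  obtain ⟨e4, e4'⟩ := d.pair_step v3 t i g hti
  set v4 := v3 * d.s i with hv4
  have f4 : d.rho w (rt i) = d.rho v4 (rt t) := by
    rw [f3, e4, e4']; module
  rcases d.len_cases v4 t with c4 | c4
  · rw [f4]
    exact IH _ (by omega) _ (by omega)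
  · exfalso
    set v5 := v4 * d.s t with hv5
    have e : w * d.s i = v5 * d.s i * d.s t * d.s i * d.s t := by
      have : v5 * d.s i * d.s t * d.s i * d.s t
        = v5 * d.s i * d.s t * d.s i * d.s t * d.s i * d.s i := by rw [d.mul_s_s]
      rw [this]
      have : v5 * d.s i * d.s t * d.s i * d.s t * d.s i * d.s i
        = v5 * (d.s i * d.s t * d.s i * d.s t * d.s i) * d.s i := by
        simp only [mul_assoc]
      rw [this, hr]
      simp only [hv5, hv4, hv3, hv2, hv1, ← mul_assoc, d.mul_s_s]
    have u1 := d.len_mul_le v5 i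
    have u2 := d.len_mul_le (v5 * d.s i) t
    have u3 := d.len_mul_le (v5 * d.s i * d.s t) i
    have u4 := d.len_mul_le (v5 * d.s i * d.s t * d.s i) t
    rw [← e] at u4
    omega

theorem key (w : W) : ∀ i, d.len w < d.len (w * d.s i) → 0 ≤ d.rho w (rt i) := by
  induction hn : d.len w using Nat.strong_induction_on generalizing w with
  | _ n IH =>
  subst hn
  have IH' : ∀ v, d.len v < d.len w → ∀ j, d.len v < d.len (v * d.s j) → 0 ≤ d.rho v (rt j) :=
    fun v hv => IH _ hv v rfl
  clear IH
  intro i hi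
  by_cases h0 : d.len w = 0
  · rw [d.eq_one_of_len h0, map_one]
    intro j
    simp only [Module.End.one_apply, rt, Pi.zero_apply]
    rw [Pi.single_apply]; split_ifs <;> norm_num
  obtain ⟨t, ht⟩ := d.exists_descent h0
  have hne : i ≠ t := by rintro rfl; omega
  have hval : ∀ i t x, bb goldenRatio goldenRatio t (rt i) = -x →
      d.rho (d.s t) (rt i) = rt i + x • rt t := by
    intro i t x h
    rw [d.rho_s, h]; module
  have c2 : d.s i * d.s t = d.s t * d.s i → bb goldenRatio goldenRatio t (rt i) = -0 →
      0 ≤ d.rho w (rt i) := fun hr h => d.dih2 w i t IH' hr (hval _ _ _ h) hi ht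
  have c3 : d.s i * d.s t * d.s i = d.s t * d.s i * d.s t →
      bb goldenRatio goldenRatio t (rt i) = -1 → bb goldenRatio goldenRatio i (rt t) = -1 →
      0 ≤ d.rho w (rt i) := fun hr h h' => d.dih3 w i t IH' hr (hval _ _ _ h) (hval _ _ _ h') hi ht
  have c5 : d.s i * d.s t * d.s i * d.s t * d.s i = d.s t * d.s i * d.s t * d.s i * d.s t →
      bb goldenRatio goldenRatio t (rt i) = -goldenRatio →
      bb goldenRatio goldenRatio i (rt t) = -goldenRatio →
      0 ≤ d.rho w (rt i) := fun hr h h' => d.dih5 w i t IH' hr (hval _ _ _ h) (hval _ _ _ h') hi ht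
  clear hval ht hi IH' h0
  simp only [bb_rt] at c2 c3 c5
  fin_cases i <;> fin_cases t
  · exact absurd rfl hne
  · exact c5 d.r01 (by simp) (by simp)
  · exact c2 d.r02 (by simp)
  · exact c2 d.r03 (by simp)
  · exact c5 d.r01.symm (by simp) (by simp)
  · exact absurd rfl hne
  · exact c3 d.r12 (by simp) (by simp)
  · exact c2 d.r13 (by simp)
  · exact c2 d.r02.symm (by simp)
  · exact c3 d.r12.symm (by simp) (by simp)
  · exact absurd rfl hne
  · exact c5 d.r23 (by simp) (by simp)
  · exact c2 d.r03.symm (by simp)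
  · exact c2 d.r13.symm (by simp)
  · exact c5 d.r23.symm (by simp) (by simp)
  · exact absurd rfl hne

theorem key_neg (w : W) (i : Fin 4) (h : d.len w = d.len (w * d.s i) + 1) :
    d.rho w (rt i) ≤ 0 := by
  have := d.key (w * d.s i) i (by rw [d.mul_s_s]; omega)
  rw [d.rho_step w i, d.rho_neg, map_neg]
  exact neg_nonpos.mpr this

theorem pos_or_neg (w : W) (i : Fin 4) : 0 ≤ d.rho w (rt i) ∨ d.rho w (rt i) ≤ 0 := by
  rcases d.len_cases w i with h | h
  · exact Or.inl (d.key w i (by omega))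
  · exact Or.inr (d.key_neg w i h)

/-- the Coxeter form -/
noncomputable def B (x y : Fin 4 → ℝ) : ℝ := ∑ i, y i * bb goldenRatio goldenRatio i x

theorem B_comm (x y : Fin 4 → ℝ) : B x y = B y x := by
  simp [B, bb, Fin.sum_univ_four]; ring

theorem B_rt (x : Fin 4 → ℝ) (i : Fin 4) : B x (rt i) = bb goldenRatio goldenRatio i x := by
  simp [B, rt, Pi.single_apply]

theorem B_inv_s (i : Fin 4) (x y : Fin 4 → ℝ) :
    B (d.rho (d.s i) x) (d.rho (d.s i) y) = B x y := by
  rw [d.rho_s, d.rho_s]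
  fin_cases i <;> simp [B, bb, rt, Fin.sum_univ_four] <;> ring

theorem word_induction {P : W → Prop} (h1 : P 1) (h : ∀ w i, P w → P (d.s i * w)) (w : W) :
    P w := by
  obtain ⟨L, rfl⟩ := d.exists_word w
  induction L with
  | nil => simpa using h1
  | cons i L ih => simpa using h _ i ih

theorem B_inv (w : W) (x y : Fin 4 → ℝ) : B (d.rho w x) (d.rho w y) = B x y := by
  induction w using d.word_induction with
  | h1 => simp
  | h w i ih => rw [map_mul, Module.End.mul_apply, Module.End.mul_apply, d.B_inv_s, ih]

theorem B_inv' (w : W) (x y : Fin 4 → ℝ) : B (d.rho w x) y = B x (d.rho w⁻¹ y) := by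
  rw [← d.B_inv w x, ← Module.End.mul_apply, ← map_mul, mul_inv_cancel, map_one]; rfl

/-- positive roots -/
def PR : Set (Fin 4 → ℝ) := {β | 0 ≤ β ∧ ∃ w i, d.rho w (rt i) = β}

theorem rt_nonneg (i : Fin 4) : 0 ≤ rt i := by
  intro j
  simp only [rt, Pi.zero_apply]
  rw [Pi.single_apply]; split_ifs <;> norm_num

theorem rt_mem (i : Fin 4) : rt i ∈ d.PR := ⟨rt_nonneg i, 1, i, by simp⟩

theorem simple_perm {β : Fin 4 → ℝ} (hβ : β ∈ d.PR) (i : Fin 4) (h : ¬ 0 ≤ d.rho (d.s i) β) :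
    β = rt i := by
  obtain ⟨h0, w, j, rfl⟩ := hβ
  have hneg : d.rho (d.s i) (d.rho w (rt j)) ≤ 0 := by
    have := d.pos_or_neg (d.s i * w) j
    rw [map_mul, Module.End.mul_apply] at this
    tauto
  have hB : B (d.rho w (rt j)) (d.rho w (rt j)) = 2 := by
    rw [d.B_inv, B_rt, bb_rt]; fin_cases j <;> simp
  set β := d.rho w (rt j)
  have hz : ∀ k, k ≠ i → β k = 0 := by
    intro k hk
    apply le_antisymm _ (h0 k)
    have := hneg k
    rw [d.rho_s] at this
    simpa [rt, Pi.single_apply, hk] using this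
  have hβ : β = β i • rt i := by
    ext k
    by_cases hk : k = i
    · subst hk; simp [rt]
    · simp [rt, Pi.single_apply, hk, hz k hk]
  have h1 : β i * β i * 2 = 2 := by
    have e : ∀ c : ℝ, B (c • rt i) (c • rt i) = c * c * B (rt i) (rt i) := by
      intro c; simp [B, bb, Fin.sum_univ_four]; ring
    have e2 : B (rt i) (rt i) = 2 := by
      rw [B_rt, bb_rt]; fin_cases i <;> simp
    rw [hβ, e, e2] at hB
    exact hB
  have h2 : β i = 1 := by
    have := h0 i
    simp only [Pi.zero_apply] at this
    nlinarith
  rw [hβ, h2, one_smul]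

theorem PR_step {β : Fin 4 → ℝ} (hβ : β ∈ d.PR) (i : Fin 4) (h : β ≠ rt i) :
    d.rho (d.s i) β ∈ d.PR := by
  refine ⟨by_contra fun h' => h (d.simple_perm hβ i h'), ?_⟩
  obtain ⟨_, w, j, rfl⟩ := hβ
  exact ⟨d.s i * w, j, by rw [map_mul]; rfl⟩

theorem fin_inv (w : W) : {β | β ∈ d.PR ∧ ¬ 0 ≤ d.rho w β}.Finite := by
  induction w using d.word_induction with
  | h1 =>
    convert Set.finite_empty
    ext β
    simp only [map_one, Module.End.one_apply, Set.mem_ofPred_eq, Set.mem_empty_iff_false, iff_false]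
    rintro ⟨h, h'⟩
    exact h' h.1
  | h w i ih =>
    refine (ih.union (Set.finite_singleton (d.rho w⁻¹ (rt i)))).subset ?_
    rintro β ⟨hβ, hn⟩
    by_cases h : 0 ≤ d.rho w β
    · right
      rw [map_mul, Module.End.mul_apply] at hn
      have hm : d.rho w β ∈ d.PR := by
        refine ⟨h, ?_⟩
        obtain ⟨_, v, j, rfl⟩ := hβ
        exact ⟨w * v, j, by rw [map_mul]; rfl⟩
      have := d.simple_perm hm i hn
      rw [Set.mem_singleton_iff, ← this, ← Module.End.mul_apply, ← map_mul, inv_mul_cancel, map_one]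
      rfl
    · exact Or.inl ⟨hβ, h⟩

theorem reduce (y : Fin 4 → ℝ) (hfin : {β | β ∈ d.PR ∧ B y β < 0}.Finite) :
    ∃ w, ∀ i, 0 ≤ bb goldenRatio goldenRatio i (d.rho w y) := by
  induction hn : {β | β ∈ d.PR ∧ B y β < 0}.ncard using Nat.strong_induction_on
    generalizing y with
  | _ n IH =>
  subst hn
  by_cases h : ∀ i, 0 ≤ bb goldenRatio goldenRatio i y
  · exact ⟨1, by simpa using h⟩
  push Not at h
  obtain ⟨i, hi⟩ := h
  have hmem : rt i ∈ {β | β ∈ d.PR ∧ B y β < 0} := ⟨d.rt_mem i, by rwa [B_rt]⟩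
  have hinv : ∀ x, d.rho (d.s i) (d.rho (d.s i) x) = x := fun x => by
    rw [← Module.End.mul_apply, ← map_mul, d.sq, map_one]; rfl
  have hB : ∀ β, B (d.rho (d.s i) y) β = B y (d.rho (d.s i) β) := fun β => by
    rw [d.B_inv', d.inv_s]
  have hsub : d.rho (d.s i) '' {β | β ∈ d.PR ∧ B (d.rho (d.s i) y) β < 0} ⊆
      {β | β ∈ d.PR ∧ B y β < 0} \ {rt i} := by
    rintro _ ⟨β, ⟨hβ, hlt⟩, rfl⟩
    rw [hB] at hlt
    have hne : β ≠ rt i := by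
      rintro rfl
      rw [d.rho_neg] at hlt
      have e : B y (-rt i) = - B y (rt i) := by simp [B]
      rw [e, B_rt] at hlt
      linarith
    refine ⟨⟨d.PR_step hβ i hne, hlt⟩, ?_⟩
    intro h
    rw [Set.mem_singleton_iff] at h
    have h' := congrArg (d.rho (d.s i)) h
    rw [hinv, d.rho_neg] at h'
    have := hβ.1 i
    rw [h'] at this
    simp [rt] at this
    linarith
  have hinj : Function.Injective (d.rho (d.s i)) := Function.LeftInverse.injective hinv
  have hfin' : {β | β ∈ d.PR ∧ B (d.rho (d.s i) y) β < 0}.Finite :=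
    ((hfin.sdiff).subset hsub).of_finite_image hinj.injOn
  have hcard : {β | β ∈ d.PR ∧ B (d.rho (d.s i) y) β < 0}.ncard <
      {β | β ∈ d.PR ∧ B y β < 0}.ncard := by
    rw [← Set.ncard_image_of_injective _ hinj]
    exact (Set.ncard_le_ncard hsub hfin.sdiff).trans_lt
      (Set.ncard_sdiff_singleton_lt_of_mem hmem hfin)
  obtain ⟨w, hw⟩ := IH _ hcard _ hfin' rfl
  refine ⟨w * d.s i, ?_⟩
  rw [map_mul]; exact hw

theorem stab (w : W) (x : Fin 4 → ℝ) (hx : ∀ i, 0 ≤ bb goldenRatio goldenRatio i x)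
    (hwx : ∀ i, 0 ≤ bb goldenRatio goldenRatio i (d.rho w x)) :
    w ∈ Subgroup.closure (d.s '' {i | bb goldenRatio goldenRatio i x = 0}) := by
  induction hn : d.len w generalizing w with
  | zero => rw [d.eq_one_of_len hn]; exact one_mem _
  | succ n ih =>
    obtain ⟨i, hi⟩ := d.exists_descent (w := w) (by omega)
    have h1 := d.key_neg w i hi
    have h2 : bb goldenRatio goldenRatio i x ≤ 0 := by
      rw [← B_rt, ← d.B_inv w]
      apply Finset.sum_nonpos
      intro j _
      exact mul_nonpos_of_nonpos_of_nonneg (h1 j) (hwx j)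
    have h3 : bb goldenRatio goldenRatio i x = 0 := le_antisymm h2 (hx i)
    have h4 : d.rho (w * d.s i) x = d.rho w x := by
      rw [map_mul, Module.End.mul_apply, d.rho_s, h3, zero_smul, sub_zero]
    have h5 := ih (w * d.s i) (by rw [h4]; exact hwx) (by omega)
    have h6 : d.s i ∈ Subgroup.closure (d.s '' {i | bb goldenRatio goldenRatio i x = 0}) :=
      Subgroup.subset_closure ⟨i, h3, rfl⟩
    have := mul_mem h5 h6
    rwa [d.mul_s_s] at this

/-- an interior point of the fundamental chamber -/
noncomputable def x0 : Fin 4 → ℝ :=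
  ![-(2 * goldenRatio + 1), -(3 * goldenRatio + 1), -(3 * goldenRatio + 1), -(2 * goldenRatio + 1)]

theorem bb_x0 (i : Fin 4) : bb goldenRatio goldenRatio i x0 = 1 := by
  have := goldenRatio_sq
  fin_cases i <;> simp [bb, x0] <;> nlinarith

theorem x0_le (w : W) : d.rho w x0 ≤ x0 := by
  induction hn : d.len w generalizing w with
  | zero => rw [d.eq_one_of_len hn, map_one]; rfl
  | succ n ih =>
    obtain ⟨i, hi⟩ := d.exists_descent (w := w) (by omega)
    have h1 := ih (w * d.s i) (by omega)
    have h2 := d.key_neg w i hi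
    have h3 : d.rho w x0 = d.rho (w * d.s i) x0 + d.rho w (rt i) := by
      rw [map_mul, Module.End.mul_apply, d.rho_s, bb_x0, one_smul, map_sub]; abel
    rw [h3]
    calc _ ≤ x0 + 0 := add_le_add h1 h2
      _ = x0 := add_zero _

theorem x0_neg : ∑ i, x0 i < 0 := by
  have := goldenRatio_pos
  simp [Fin.sum_univ_four, x0]; linarith

theorem torsion (g : W) (hg : g ^ 5 = 1) :
    ∃ w : W, ∃ j : Fin 4, w * g * w⁻¹ ∈ Subgroup.closure (d.s '' {i | i ≠ j}) := by
  set y : Fin 4 → ℝ := ∑ k ∈ Finset.range 5, d.rho (g ^ k) x0 with hy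
  have hfix : d.rho g y = y := by
    rw [hy, map_sum]
    have : ∀ k, d.rho g (d.rho (g ^ k) x0) = d.rho (g ^ (k + 1)) x0 := fun k => by
      rw [pow_succ', map_mul]; rfl
    simp only [this]
    rw [Finset.sum_range_succ, hg, Finset.sum_range_succ' _ 4, pow_zero]
  have hBsum : ∀ β, B y β = ∑ k ∈ Finset.range 5, B (d.rho (g ^ k) x0) β := by
    intro β
    rw [hy, B_comm]
    simp only [B_comm _ β]
    simp only [B, Finset.sum_apply, Finset.sum_mul]
    rw [Finset.sum_comm]
  have hneg : B y x0 < 0 := by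
    rw [hBsum]
    apply Finset.sum_neg (fun k _ => ?_) ⟨0, by simp⟩
    rw [B_comm]
    simp only [B, bb_x0, mul_one]
    exact (Finset.sum_le_sum fun j _ => d.x0_le (g ^ k) j).trans_lt x0_neg
  have hfin : {β | β ∈ d.PR ∧ B y β < 0}.Finite := by
    refine (Set.Finite.biUnion (Finset.range 5).finite_toSet
      (fun k _ => d.fin_inv (g ^ k)⁻¹)).subset ?_
    rintro β ⟨hβ, hlt⟩
    rw [hBsum] at hlt
    obtain ⟨k, hk, hlt⟩ := Finset.exists_lt_of_sum_lt
      (s := Finset.range 5) (f := fun k => B (d.rho (g ^ k) x0) β) (g := fun _ => (0 : ℝ))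
      (by rw [Finset.sum_const_zero]; exact hlt)
    simp only [Set.mem_iUnion]
    refine ⟨k, hk, hβ, fun h => ?_⟩
    rw [d.B_inv'] at hlt
    have : 0 ≤ B x0 (d.rho (g ^ k)⁻¹ β) := by
      simp only [B, bb_x0, mul_one]
      exact Finset.sum_nonneg fun j _ => h j
    linarith
  obtain ⟨w, hw⟩ := d.reduce y hfin
  have hfix' : d.rho (w * g * w⁻¹) (d.rho w y) = d.rho w y := by
    rw [← Module.End.mul_apply, ← map_mul, inv_mul_cancel_right, map_mul, Module.End.mul_apply, hfix]
  have hst := d.stab (w * g * w⁻¹) (d.rho w y) hw (by rw [hfix']; exact hw)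
  have hj : ∃ j, bb goldenRatio goldenRatio j (d.rho w y) ≠ 0 := by
    by_contra hcon
    push Not at hcon
    have : B (d.rho w y) (d.rho w x0) = 0 := by
      simp [B, hcon]
    rw [d.B_inv] at this
    linarith
  obtain ⟨j, hj⟩ := hj
  refine ⟨w, j, Subgroup.closure_mono (Set.image_mono ?_) hst⟩
  intro i hi h
  subst h
  exact hj hi
end TitsData
end Tits

section Concrete
open Real

/-- The reflection matrices of the Coxeter form with parameters `p`, `q`. -/
def reflM (p q : ℝ) : Fin 4 → Matrix (Fin 4) (Fin 4) ℝ :=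
  ![!![-1, p, 0, 0; 0, 1, 0, 0; 0, 0, 1, 0; 0, 0, 0, 1],
    !![1, 0, 0, 0; p, -1, 1, 0; 0, 0, 1, 0; 0, 0, 0, 1],
    !![1, 0, 0, 0; 0, 1, 0, 0; 0, 1, -1, q; 0, 0, 0, 1],
    !![1, 0, 0, 0; 0, 1, 0, 0; 0, 0, 1, 0; 0, 0, q, -1]]

theorem reflM_sq (p q : ℝ) (i : Fin 4) : reflM p q i * reflM p q i = 1 := by
  fin_cases i <;> ext k l <;> fin_cases k <;> fin_cases l <;>
    simp [reflM, Matrix.mul_apply, Fin.sum_univ_four]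

/-- The reflections as units. -/
def reflU (p q : ℝ) (i : Fin 4) : (Matrix (Fin 4) (Fin 4) ℝ)ˣ :=
  ⟨reflM p q i, reflM p q i, reflM_sq p q i, reflM_sq p q i⟩

theorem reflU_sq (p q : ℝ) (i : Fin 4) : reflU p q i * reflU p q i = 1 :=
  Units.ext (reflM_sq p q i)

theorem reflU_02 (p q : ℝ) : reflU p q 0 * reflU p q 2 = reflU p q 2 * reflU p q 0 := by
  apply Units.ext
  simp only [reflU, Units.val_mul]
  ext k l
  fin_cases k <;> fin_cases l <;> simp [reflM, Matrix.mul_apply, Fin.sum_univ_four]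

theorem reflU_03 (p q : ℝ) : reflU p q 0 * reflU p q 3 = reflU p q 3 * reflU p q 0 := by
  apply Units.ext
  simp only [reflU, Units.val_mul]
  ext k l
  fin_cases k <;> fin_cases l <;> simp [reflM, Matrix.mul_apply, Fin.sum_univ_four]

theorem reflU_13 (p q : ℝ) : reflU p q 1 * reflU p q 3 = reflU p q 3 * reflU p q 1 := by
  apply Units.ext
  simp only [reflU, Units.val_mul]
  ext k l
  fin_cases k <;> fin_cases l <;> simp [reflM, Matrix.mul_apply, Fin.sum_univ_four]

theorem reflU_12 (p q : ℝ) : (reflU p q 1 * reflU p q 2) ^ 3 = 1 := by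
  apply Units.ext
  have h1 : reflM p q 1 * reflM p q 2 =
      !![1, 0, 0, 0; p, 0, -1, q; 0, 1, -1, q; 0, 0, 0, 1] := by
    ext k l
    fin_cases k <;> fin_cases l <;> simp [reflM, Matrix.mul_apply, Fin.sum_univ_four]
  simp only [reflU, Units.val_mul, Units.val_pow_eq_pow_val, h1, Units.val_one]
  rw [pow_succ, pow_succ, pow_one]
  ext k l
  fin_cases k <;> fin_cases l <;> simp [Matrix.mul_apply, Fin.sum_univ_four]

theorem reflM_10 (p q : ℝ) (hp : p * p = p + 1) : reflM p q 1 * reflM p q 0 =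
    !![-1, p, 0, 0; -p, p, 1, 0; 0, 0, 1, 0; 0, 0, 0, 1] := by
  ext k l
  fin_cases k <;> fin_cases l <;> simp [reflM, Matrix.mul_apply, Fin.sum_univ_four] <;> grind

theorem reflM_10_sq (p q : ℝ) (hp : p * p = p + 1) :
    (reflM p q 1 * reflM p q 0) * (reflM p q 1 * reflM p q 0) =
    !![-p, 1, p, 0; -1, 0, 1 + p, 0; 0, 0, 1, 0; 0, 0, 0, 1] := by
  rw [reflM_10 p q hp]
  ext k l
  fin_cases k <;> fin_cases l <;> simp [Matrix.mul_apply, Fin.sum_univ_four] <;> grind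

theorem reflU_10 (p q : ℝ) (hp : p * p = p + 1) : (reflU p q 1 * reflU p q 0) ^ 5 = 1 := by
  apply Units.ext
  have e : ∀ A : Matrix (Fin 4) (Fin 4) ℝ, A ^ 5 = (A * A) * ((A * A) * A) := fun A => by
    simp only [pow_succ, pow_zero, one_mul, mul_assoc]
  simp only [reflU, Units.val_mul, Units.val_pow_eq_pow_val, Units.val_one]
  rw [e, reflM_10_sq p q hp, reflM_10 p q hp]
  ext k l
  fin_cases k <;> fin_cases l <;> simp [Matrix.mul_apply, Fin.sum_univ_four] <;> grind

theorem reflM_23 (p q : ℝ) (hq : q * q = q + 1) : reflM p q 2 * reflM p q 3 =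
    !![1, 0, 0, 0; 0, 1, 0, 0; 0, 1, q, -q; 0, 0, q, -1] := by
  ext k l
  fin_cases k <;> fin_cases l <;> simp [reflM, Matrix.mul_apply, Fin.sum_univ_four] <;> grind

theorem reflM_23_sq (p q : ℝ) (hq : q * q = q + 1) :
    (reflM p q 2 * reflM p q 3) * (reflM p q 2 * reflM p q 3) =
    !![1, 0, 0, 0; 0, 1, 0, 0; 0, 1 + q, 0, -1; 0, q, 1, -q] := by
  rw [reflM_23 p q hq]
  ext k l
  fin_cases k <;> fin_cases l <;> simp [Matrix.mul_apply, Fin.sum_univ_four] <;> grind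

theorem reflU_23 (p q : ℝ) (hq : q * q = q + 1) : (reflU p q 2 * reflU p q 3) ^ 5 = 1 := by
  apply Units.ext
  have e : ∀ A : Matrix (Fin 4) (Fin 4) ℝ, A ^ 5 = (A * A) * ((A * A) * A) := fun A => by
    simp only [pow_succ, pow_zero, one_mul, mul_assoc]
  simp only [reflU, Units.val_mul, Units.val_pow_eq_pow_val, Units.val_one]
  rw [e, reflM_23_sq p q hq, reflM_23 p q hq]
  ext k l
  fin_cases k <;> fin_cases l <;> simp [Matrix.mul_apply, Fin.sum_univ_four] <;> grind

/-- A homomorphism out of `Γ⁺` from three elements satisfying the relations. -/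
def homOf {H : Type*} [Group H] (a b c : H) (ha : a ^ 2 = 1) (hb : b ^ 2 = 1) (hc : c ^ 5 = 1)
    (hbc : (b * c) ^ 2 = 1) (hca : (c * a) ^ 3 = 1) (hab : (a * b) ^ 5 = 1) : GammaPlus →* H :=
  PresentedGroup.toGroup (f := fun g => match g with | Gen.a => a | Gen.b => b | Gen.c => c) (by
    intro r hr
    simp only [rels, Set.mem_insert_iff, Set.mem_singleton_iff] at hr
    rcases hr with rfl | rfl | rfl | rfl | rfl | rfl <;>
      simp only [map_pow, map_mul, FreeGroup.lift_apply_of] <;> assumption)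

/-- generators -/
def gA : GammaPlus := PresentedGroup.of Gen.a
/-- generators -/
def gB : GammaPlus := PresentedGroup.of Gen.b
/-- generators -/
def gC : GammaPlus := PresentedGroup.of Gen.c

section
variable {H : Type*} [Group H] (a b c : H) (ha : a ^ 2 = 1) (hb : b ^ 2 = 1) (hc : c ^ 5 = 1)
    (hbc : (b * c) ^ 2 = 1) (hca : (c * a) ^ 3 = 1) (hab : (a * b) ^ 5 = 1)
theorem homOf_A : homOf a b c ha hb hc hbc hca hab gA = a := PresentedGroup.toGroup.of _
theorem homOf_B : homOf a b c ha hb hc hbc hca hab gB = b := PresentedGroup.toGroup.of _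
theorem homOf_C : homOf a b c ha hb hc hbc hca hab gC = c := PresentedGroup.toGroup.of _
end

theorem rel_mk {r : FreeGroup Gen} (h : r ∈ rels) : PresentedGroup.mk rels r = 1 :=
  PresentedGroup.one_of_mem h

theorem relA : gA ^ 2 = 1 := rel_mk (r := FreeGroup.of Gen.a ^ 2) (by simp [rels])
theorem relB : gB ^ 2 = 1 := rel_mk (r := FreeGroup.of Gen.b ^ 2) (by simp [rels])
theorem relC : gC ^ 5 = 1 := rel_mk (r := FreeGroup.of Gen.c ^ 5) (by simp [rels])
theorem relBC : (gB * gC) ^ 2 = 1 :=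
  rel_mk (r := (FreeGroup.of Gen.b * FreeGroup.of Gen.c) ^ 2) (by simp [rels])
theorem relCA : (gC * gA) ^ 3 = 1 :=
  rel_mk (r := (FreeGroup.of Gen.c * FreeGroup.of Gen.a) ^ 3) (by simp [rels])
theorem relAB : (gA * gB) ^ 5 = 1 :=
  rel_mk (r := (FreeGroup.of Gen.a * FreeGroup.of Gen.b) ^ 5) (by simp [rels])

theorem hom_ext' {H : Type*} [Group H] {f g : GammaPlus →* H} (ha : f gA = g gA)
    (hb : f gB = g gB) (hc : f gC = g gC) : f = g := by
  apply PresentedGroup.ext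
  intro x
  cases x
  · exact ha
  · exact hb
  · exact hc

/-- The geometric representation of `Γ⁺`. -/
noncomputable def rep (p q : ℝ) (hp : p * p = p + 1) (hq : q * q = q + 1) :
    GammaPlus →* (Matrix (Fin 4) (Fin 4) ℝ)ˣ :=
  homOf (reflU p q 0 * reflU p q 2) (reflU p q 0 * reflU p q 3) (reflU p q 1 * reflU p q 0)
    (by rw [sq]; nth_rewrite 2 [reflU_02]
        rw [mul_assoc, ← mul_assoc (reflU p q 2), reflU_sq, one_mul, reflU_sq])
    (by rw [sq]; nth_rewrite 2 [reflU_03]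
        rw [mul_assoc, ← mul_assoc (reflU p q 3), reflU_sq, one_mul, reflU_sq])
    (reflU_10 p q hp)
    (by
      have e : reflU p q 0 * reflU p q 3 * (reflU p q 1 * reflU p q 0) =
          reflU p q 0 * (reflU p q 3 * reflU p q 1) * (reflU p q 0)⁻¹ := by
        rw [show (reflU p q 0)⁻¹ = reflU p q 0 by
          rw [inv_eq_iff_mul_eq_one]; exact reflU_sq p q 0]
        simp only [mul_assoc]
      rw [e, conj_pow, sq]
      nth_rewrite 1 [← reflU_13]
      rw [mul_assoc (reflU p q 1), ← mul_assoc (reflU p q 3) (reflU p q 3), reflU_sq, one_mul,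
        reflU_sq, mul_one, mul_inv_cancel])
    (by rw [mul_assoc, ← mul_assoc (reflU p q 0) (reflU p q 0), reflU_sq, one_mul, reflU_12])
    (by rw [reflU_02, mul_assoc, ← mul_assoc (reflU p q 0) (reflU p q 0), reflU_sq, one_mul,
          reflU_23 p q hq])

/-- trace in the geometric representation -/
noncomputable def tr (p q : ℝ) (hp : p * p = p + 1) (hq : q * q = q + 1) (g : GammaPlus) : ℝ :=
  Matrix.trace (rep p q hp hq g : Matrix (Fin 4) (Fin 4) ℝ)

section
variable (p q : ℝ) (hp : p * p = p + 1) (hq : q * q = q + 1)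

theorem rep_C : rep p q hp hq gC = reflU p q 1 * reflU p q 0 := homOf_C _ _ _ _ _ _ _ _ _
theorem rep_A : rep p q hp hq gA = reflU p q 0 * reflU p q 2 := homOf_A _ _ _ _ _ _ _ _ _
theorem rep_B : rep p q hp hq gB = reflU p q 0 * reflU p q 3 := homOf_B _ _ _ _ _ _ _ _ _
theorem rep_AB : rep p q hp hq (gA * gB) = reflU p q 2 * reflU p q 3 := by
  rw [map_mul, rep_A, rep_B, reflU_02, mul_assoc, ← mul_assoc (reflU p q 0) (reflU p q 0),
    reflU_sq, one_mul]

theorem tr_conj {g h : GammaPlus} (H : IsConj g h) : tr p q hp hq g = tr p q hp hq h := by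
  obtain ⟨c, rfl⟩ := isConj_iff.1 H
  simp only [tr, map_mul, map_inv, Units.val_mul]
  rw [Matrix.trace_mul_comm, ← mul_assoc, ← Units.val_mul, inv_mul_cancel, Units.val_one, one_mul]

theorem tr_one : tr p q hp hq 1 = 4 := by
  simp [tr]

theorem tr_C : tr p q hp hq gC = p + 1 := by
  rw [tr, rep_C]
  simp only [reflU, Units.val_mul]
  rw [reflM_10 p q hp]
  simp [Matrix.trace, Fin.sum_univ_four]

theorem tr_C2 : tr p q hp hq (gC ^ 2) = 2 - p := by
  rw [tr, map_pow, rep_C, sq]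
  simp only [reflU, Units.val_mul]
  rw [reflM_10_sq p q hp]
  simp [Matrix.trace, Fin.sum_univ_four]; ring

theorem tr_AB : tr p q hp hq (gA * gB) = q + 1 := by
  rw [tr, rep_AB]
  simp only [reflU, Units.val_mul]
  rw [reflM_23 p q hq]
  simp [Matrix.trace, Fin.sum_univ_four]; ring

theorem tr_AB2 : tr p q hp hq ((gA * gB) ^ 2) = 2 - q := by
  rw [tr, map_pow, rep_AB, sq]
  simp only [reflU, Units.val_mul]
  rw [reflM_23_sq p q hq]
  simp [Matrix.trace, Fin.sum_univ_four]; ring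
end

/-- homomorphism from the sign group -/
def unitsHom {H : Type*} [Group H] (u : H) (hu : u * u = 1) : ℤˣ →* H where
  toFun e := if e = 1 then 1 else u
  map_one' := by simp
  map_mul' x y := by
    rcases Int.units_eq_one_or x with rfl | rfl <;> rcases Int.units_eq_one_or y with rfl | rfl <;>
      simp [hu]

theorem unitsHom_neg {H : Type*} [Group H] (u : H) (hu : u * u = 1) : unitsHom u hu (-1) = u := by
  simp [unitsHom]

theorem invC : gB * gC * gB⁻¹ = gC⁻¹ := by
  have hb : gB⁻¹ = gB := by rw [inv_eq_iff_mul_eq_one, ← sq, relB]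
  have h := relBC
  rw [hb, eq_comm, inv_eq_iff_mul_eq_one]
  have h2 : gB * (gC * (gB * gC * gB)) * gB = 1 := by
    have : gB * (gC * (gB * gC * gB)) * gB = (gB * gC) ^ 2 * (gB * gB) := by
      simp only [sq, mul_assoc]
    rw [this, h, ← sq, relB, mul_one]
  have := congrArg (fun t => gB * t * gB) h2
  have hbb : gB * gB = 1 := by rw [← sq, relB]
  have hbb' : ∀ t, gB * (gB * t) = t := fun t => by rw [← mul_assoc, hbb, one_mul]
  simpa only [mul_assoc, hbb, hbb', mul_one] using this

/-- conjugation by the reflection `s 0` -/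
def sigmaHom : GammaPlus →* GammaPlus :=
  homOf gA gB gC⁻¹ relA relB (by rw [inv_pow, relC, inv_one])
    (by
      have hb : gB⁻¹ = gB := by rw [inv_eq_iff_mul_eq_one, ← sq, relB]
      have : gB * gC⁻¹ = gB * (gB * gC)⁻¹ * gB⁻¹ := by rw [mul_inv_rev, hb]; simp [mul_assoc, ← sq, relB]
      rw [this, conj_pow, inv_pow, relBC]; simp)
    (by
      have ha : gA⁻¹ = gA := by rw [inv_eq_iff_mul_eq_one, ← sq, relA]
      have : gC⁻¹ * gA = gA⁻¹ * (gC * gA)⁻¹ * (gA⁻¹)⁻¹ := by rw [mul_inv_rev, ha]; simp [← mul_assoc, ← sq, relA, ha]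
      rw [this, conj_pow, inv_pow, relCA]; simp)
    relAB

theorem sigmaHom_A : sigmaHom gA = gA := homOf_A _ _ _ _ _ _ _ _ _
theorem sigmaHom_B : sigmaHom gB = gB := homOf_B _ _ _ _ _ _ _ _ _
theorem sigmaHom_C : sigmaHom gC = gC⁻¹ := homOf_C _ _ _ _ _ _ _ _ _

theorem sigma_sigma : sigmaHom.comp sigmaHom = MonoidHom.id _ := by
  apply hom_ext' <;> simp [sigmaHom_A, sigmaHom_B, sigmaHom_C]

/-- the involution as an automorphism -/
def sigma : MulAut GammaPlus := MonoidHom.toMulEquiv sigmaHom sigmaHom sigma_sigma sigma_sigma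

theorem sigma_apply (x : GammaPlus) : sigma x = sigmaHom x := rfl

theorem sigma_sq : sigma * sigma = 1 := by
  ext x
  exact DFunLike.congr_fun sigma_sigma x

/-- the action defining the semidirect product -/
def act : ℤˣ →* MulAut GammaPlus := unitsHom sigma sigma_sq

/-- The full reflection group. -/
abbrev WW := GammaPlus ⋊[act] ℤˣ

open SemidirectProduct in
/-- the reflection `s 0` -/
def TT : WW := inr (-1)

open SemidirectProduct in
theorem TT_sq : TT * TT = 1 := by
  rw [TT, ← map_mul]; simp

open SemidirectProduct in
theorem TT_inl (x : GammaPlus) : TT * inl x = inl (sigmaHom x) * TT := by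
  have h : inl (act (-1) x) = TT * inl x * inr (-1)⁻¹ := inl_aut _ _
  have e : act (-1) x = sigmaHom x := by rw [act, unitsHom_neg, sigma_apply]
  rw [e] at h
  rw [h, TT]
  simp only [map_inv, inv_mul_cancel_right]

/-- translation parts of the reflections -/
def xs : Fin 4 → GammaPlus := ![1, gC, gA, gB]

open SemidirectProduct in
/-- the simple reflections -/
def ss (i : Fin 4) : WW := inl (xs i) * TT

open SemidirectProduct in
theorem ss_mul (i j : Fin 4) : ss i * ss j = inl (xs i * sigmaHom (xs j)) := by
  rw [ss, ss, mul_assoc, ← mul_assoc TT, TT_inl, mul_assoc, TT_sq, mul_one, map_mul]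

theorem ss_sq (i : Fin 4) : ss i * ss i = 1 := by
  have e : xs i * sigmaHom (xs i) = 1 := by
    fin_cases i
    · simp [xs]
    · simp [xs, sigmaHom_C]
    · simp [xs, sigmaHom_A, ← sq, relA]
    · simp [xs, sigmaHom_B, ← sq, relB]
  rw [ss_mul, e, map_one]

theorem braid2 {G : Type*} [Group G] {s t : G} (hs : s * s = 1) (ht : t * t = 1)
    (h : (s * t) ^ 2 = 1) : s * t = t * s := by
  have hs' : s⁻¹ = s := by rw [inv_eq_iff_mul_eq_one]; exact hs
  have ht' : t⁻¹ = t := by rw [inv_eq_iff_mul_eq_one]; exact ht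
  rw [sq] at h
  rw [eq_inv_of_mul_eq_one_left h, mul_inv_rev, hs', ht']

theorem braid3 {G : Type*} [Group G] {s t : G} (hs : s * s = 1) (ht : t * t = 1)
    (h : (s * t) ^ 3 = 1) : s * t * s = t * s * t := by
  have hs' : s⁻¹ = s := by rw [inv_eq_iff_mul_eq_one]; exact hs
  have ht' : t⁻¹ = t := by rw [inv_eq_iff_mul_eq_one]; exact ht
  have h' : (s * t * s) * (t * s * t) = 1 := by
    rw [← h]; simp only [pow_succ, pow_zero, one_mul, mul_assoc]
  rw [eq_inv_of_mul_eq_one_left h']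
  simp only [mul_inv_rev, hs', ht', mul_assoc]

theorem braid5 {G : Type*} [Group G] {s t : G} (hs : s * s = 1) (ht : t * t = 1)
    (h : (s * t) ^ 5 = 1) : s * t * s * t * s = t * s * t * s * t := by
  have hs' : s⁻¹ = s := by rw [inv_eq_iff_mul_eq_one]; exact hs
  have ht' : t⁻¹ = t := by rw [inv_eq_iff_mul_eq_one]; exact ht
  have h' : (s * t * s * t * s) * (t * s * t * s * t) = 1 := by
    rw [← h]; simp only [pow_succ, pow_zero, one_mul, mul_assoc]
  rw [eq_inv_of_mul_eq_one_left h']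
  simp only [mul_inv_rev, hs', ht', mul_assoc]

theorem relCB : (gC * gB) ^ 2 = 1 := by
  have : gC * gB = gB⁻¹ * (gB * gC) * (gB⁻¹)⁻¹ := by group
  rw [this, conj_pow, relBC]; group

theorem golden_mul : goldenRatio * goldenRatio = goldenRatio + 1 := by
  rw [← sq, goldenRatio_sq]

/-- the representation of the full reflection group -/
noncomputable def repW : WW →* (Matrix (Fin 4) (Fin 4) ℝ)ˣ :=
  SemidirectProduct.lift (rep goldenRatio goldenRatio golden_mul golden_mul)
    (unitsHom (reflU goldenRatio goldenRatio 0) (reflU_sq _ _ 0)) (by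
      intro e
      rcases Int.units_eq_one_or e with rfl | rfl
      · ext1 x; simp
      · have hi : ∀ i, (reflU goldenRatio goldenRatio i)⁻¹ = reflU goldenRatio goldenRatio i := by
          intro i
          rw [inv_eq_iff_mul_eq_one]; exact reflU_sq _ _ _
        rw [act, unitsHom_neg, unitsHom_neg]
        apply hom_ext'
        · simp only [MonoidHom.comp_apply, MulEquiv.coe_toMonoidHom, sigma_apply, sigmaHom_A, rep_A,
            MulAut.conj_apply]
          rw [hi, ← mul_assoc (reflU _ _ 0), reflU_sq, one_mul, reflU_02]
        · simp only [MonoidHom.comp_apply, MulEquiv.coe_toMonoidHom, sigma_apply, sigmaHom_B, rep_B,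
            MulAut.conj_apply]
          rw [hi, ← mul_assoc (reflU _ _ 0), reflU_sq, one_mul, reflU_03]
        · simp only [MonoidHom.comp_apply, MulEquiv.coe_toMonoidHom, sigma_apply, sigmaHom_C, rep_C,
            MulAut.conj_apply, map_inv, mul_inv_rev]
          rw [hi, hi, mul_assoc, mul_assoc, reflU_sq, mul_one])

theorem repW_inl (x : GammaPlus) : repW (SemidirectProduct.inl x) =
    rep goldenRatio goldenRatio golden_mul golden_mul x :=
  SemidirectProduct.lift_inl _ _ _ _

theorem repW_TT : repW TT = reflU goldenRatio goldenRatio 0 := by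
  have : repW TT = unitsHom (reflU goldenRatio goldenRatio 0) (reflU_sq _ _ 0) (-1) :=
    SemidirectProduct.lift_inr _ _ _ _
  rw [this, unitsHom_neg]

theorem repW_ss (i : Fin 4) : repW (ss i) = reflU goldenRatio goldenRatio i := by
  rw [ss, map_mul, repW_inl, repW_TT]
  fin_cases i
  · simp [xs]
  · simp only [xs, Fin.mk_one, Matrix.cons_val]
    rw [rep_C, mul_assoc, reflU_sq, mul_one]
  · simp only [xs, Fin.reduceFinMk, Matrix.cons_val]
    rw [rep_A, reflU_02, mul_assoc, reflU_sq, mul_one]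
  · simp only [xs, Fin.reduceFinMk, Matrix.cons_val]
    rw [rep_B, reflU_03, mul_assoc, reflU_sq, mul_one]

theorem ss_zero : ss 0 = TT := by simp [ss, xs]

open SemidirectProduct in
theorem ss_gen : Subgroup.closure (Set.range ss) = ⊤ := by
  rw [eq_top_iff]
  set K := Subgroup.closure (Set.range ss)
  have hs : ∀ i, ss i ∈ K := fun i => Subgroup.subset_closure ⟨i, rfl⟩
  have hT : TT ∈ K := by rw [← ss_zero]; exact hs 0
  have hx : ∀ i, inl (xs i) ∈ K := fun i => by
    have : inl (xs i) = ss i * TT := by rw [ss, mul_assoc, TT_sq, mul_one]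
    rw [this]; exact mul_mem (hs i) hT
  have hN : ∀ n : GammaPlus, inl n ∈ K := by
    have : (⊤ : Subgroup GammaPlus) ≤ K.comap inl := by
      rw [← PresentedGroup.closure_range_of, Subgroup.closure_le]
      rintro _ ⟨x, rfl⟩
      cases x
      · exact hx 2
      · exact hx 3
      · exact hx 1
    exact fun n => this trivial
  rintro w -
  rw [← inl_left_mul_inr_right w]
  apply mul_mem (hN _)
  rcases Int.units_eq_one_or w.right with h | h <;> rw [h]
  · rw [map_one]; exact one_mem _
  · exact hT

/-- The Tits data of the full reflection group. -/
noncomputable def titsWW : TitsData WW where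
  s := ss
  sq := ss_sq
  gen := ss_gen
  r01 := (braid5 (ss_sq 1) (ss_sq 0) (by
    rw [ss_mul, ← map_pow]; simp [xs, relC])).symm
  r23 := braid5 (ss_sq 2) (ss_sq 3) (by
    rw [ss_mul, ← map_pow]; simp [xs, sigmaHom_B, relAB])
  r12 := braid3 (ss_sq 1) (ss_sq 2) (by
    rw [ss_mul, ← map_pow]; simp [xs, sigmaHom_A, relCA])
  r02 := braid2 (ss_sq 0) (ss_sq 2) (by
    rw [ss_mul, ← map_pow]; simp [xs, sigmaHom_A, relA])
  r03 := braid2 (ss_sq 0) (ss_sq 3) (by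
    rw [ss_mul, ← map_pow]; simp [xs, sigmaHom_B, relB])
  r13 := braid2 (ss_sq 1) (ss_sq 3) (by
    rw [ss_mul, ← map_pow]; simp [xs, sigmaHom_B, relCB])
  rho := ((Matrix.toLinAlgEquiv' : Matrix (Fin 4) (Fin 4) ℝ ≃ₐ[ℝ] _) :
      Matrix (Fin 4) (Fin 4) ℝ →* Module.End ℝ (Fin 4 → ℝ)).comp ((Units.coeHom _).comp repW)
  rho_s := by
    intro i x
    have : (((Matrix.toLinAlgEquiv' : Matrix (Fin 4) (Fin 4) ℝ ≃ₐ[ℝ] _) :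
      Matrix (Fin 4) (Fin 4) ℝ →* Module.End ℝ (Fin 4 → ℝ)).comp ((Units.coeHom _).comp repW))
        (ss i) x = (reflM goldenRatio goldenRatio i).mulVec x := by
      simp [repW_ss, reflU, Matrix.toLinAlgEquiv'_apply]
    rw [this]
    ext k
    fin_cases i <;> fin_cases k <;>
      simp [reflM, bb, rt, Matrix.mulVec, dotProduct, Fin.sum_univ_four] <;> ring
  sgn := SemidirectProduct.rightHom
  sgn_s := by
    intro i
    simp [ss, TT]

open SemidirectProduct in
theorem parab (i0 j : Fin 4) (S : Set GammaPlus) (hi0 : i0 ≠ j)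
    (h1 : ∀ i, i ≠ j → ∃ k ∈ Subgroup.closure S, ss i = inl k * ss i0)
    (h2 : ∀ x ∈ S, ∃ x' ∈ Subgroup.closure S, ss i0 * inl x = inl x' * ss i0)
    (g : GammaPlus) (w : WW)
    (hw : w * inl g * w⁻¹ ∈ Subgroup.closure (ss '' {i | i ≠ j})) :
    ∃ n : GammaPlus, n * g * n⁻¹ ∈ Subgroup.closure S := by
  have hssinv : ∀ i, (ss i)⁻¹ = ss i := fun i => by
    rw [inv_eq_iff_mul_eq_one]; exact ss_sq i
  have hright : ∀ i, (ss i).right = -1 := fun i => by simp [ss, TT]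
  have h2' : ∀ x ∈ Subgroup.closure S, ∃ x' ∈ Subgroup.closure S,
      ss i0 * inl x = inl x' * ss i0 := by
    intro x hx
    induction hx using Subgroup.closure_induction with
    | mem x hx => exact h2 x hx
    | one => exact ⟨1, one_mem _, by simp⟩
    | mul x y _ _ hx hy =>
      obtain ⟨x', hx', ex⟩ := hx
      obtain ⟨y', hy', ey⟩ := hy
      refine ⟨x' * y', mul_mem hx' hy', ?_⟩
      rw [map_mul, ← mul_assoc, ex, mul_assoc, ey, ← mul_assoc, map_mul]
    | inv x _ hx =>
      obtain ⟨x', hx', ex⟩ := hx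
      refine ⟨x'⁻¹, inv_mem hx', ?_⟩
      rw [map_inv, map_inv, mul_inv_eq_iff_eq_mul, mul_assoc, ex, inv_mul_cancel_left]
  have main : ∀ h ∈ Subgroup.closure (ss '' {i | i ≠ j}),
      ∃ k ∈ Subgroup.closure S, h = inl k ∨ h = inl k * ss i0 := by
    have step : ∀ (h : WW) (i : Fin 4), i ≠ j →
        (∃ k ∈ Subgroup.closure S, h = inl k ∨ h = inl k * ss i0) →
        (∃ k ∈ Subgroup.closure S, h * ss i = inl k ∨ h * ss i = inl k * ss i0) := by
      rintro h i hi ⟨k, hk, rfl | rfl⟩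
      · obtain ⟨k', hk', e⟩ := h1 i hi
        exact ⟨k * k', mul_mem hk hk', Or.inr (by rw [e, map_mul, mul_assoc])⟩
      · obtain ⟨k', hk', e⟩ := h1 i hi
        obtain ⟨k'', hk'', e'⟩ := h2' k' hk'
        refine ⟨k * k'', mul_mem hk hk'', Or.inl ?_⟩
        rw [e, mul_assoc, ← mul_assoc (ss i0), e', mul_assoc, ss_sq, mul_one, map_mul]
    intro h hh
    induction hh using Subgroup.closure_induction_right with
    | one => exact ⟨1, one_mem _, Or.inl (by simp)⟩
    | mul_right x hx y hy ih =>
      obtain ⟨i, hi, rfl⟩ := hy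
      exact step x i hi ih
    | mul_inv_cancel x hx y hy ih =>
      obtain ⟨i, hi, rfl⟩ := hy
      rw [hssinv]
      exact step x i hi ih
  have fin : ∀ n : GammaPlus, inl n * inl g * (inl n)⁻¹ ∈ Subgroup.closure (ss '' {i | i ≠ j}) →
      ∃ n : GammaPlus, n * g * n⁻¹ ∈ Subgroup.closure S := by
    intro n hn
    refine ⟨n, ?_⟩
    obtain ⟨k, hk, e | e⟩ := main _ hn
    · have : n * g * n⁻¹ = k := by
        apply inl_injective (φ := act)
        rw [← e]; simp
      rwa [this]
    · exfalso
      have := congrArg SemidirectProduct.right e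
      simp [hright] at this
  rcases Int.units_eq_one_or w.right with h | h
  · have e : w = inl w.left := by
      conv_lhs => rw [← inl_left_mul_inr_right w, h, map_one, mul_one]
    rw [e] at hw
    exact fin _ hw
  · have hr : (ss i0 * w).right = 1 := by rw [mul_right, hright, h]; simp
    have e : ss i0 * w = inl (ss i0 * w).left := by
      conv_lhs => rw [← inl_left_mul_inr_right (ss i0 * w), hr, map_one, mul_one]
    apply fin (ss i0 * w).left
    rw [← e]
    have hm : ss i0 ∈ Subgroup.closure (ss '' {i | i ≠ j}) :=
      Subgroup.subset_closure ⟨i0, hi0, rfl⟩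
    have := mul_mem (mul_mem hm hw) (inv_mem hm)
    convert this using 1
    group

theorem invB : gB⁻¹ = gB := by rw [inv_eq_iff_mul_eq_one, ← sq, relB]
theorem invA : gA⁻¹ = gA := by rw [inv_eq_iff_mul_eq_one, ← sq, relA]

theorem invAB : gA * (gA * gB) * gA⁻¹ = (gA * gB)⁻¹ := by
  rw [mul_inv_rev, invA, invB, ← mul_assoc, ← sq, relA, one_mul]

theorem relBA : (gB * gA) ^ 5 = 1 := by
  have : gB * gA = (gA * gB)⁻¹ := by rw [mul_inv_rev, invA, invB]
  rw [this, inv_pow, relAB, inv_one]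

open SemidirectProduct in
theorem torsion_five (g : GammaPlus) (hg : g ^ 5 = 1) :
    ∃ n : GammaPlus, ∃ k < 5, g = n⁻¹ * gC ^ k * n ∨ g = n⁻¹ * (gA * gB) ^ k * n := by
  obtain ⟨w, j, hw⟩ := titsWW.torsion (inl g) (by rw [← map_pow, hg, map_one])
  change w * inl g * w⁻¹ ∈ Subgroup.closure (ss '' {i | i ≠ j}) at hw
  have fin : ∀ (x y : GammaPlus), (∃ n : GammaPlus, n * g * n⁻¹ ∈ Subgroup.closure {x, y}) →
      (∀ g ∈ Subgroup.closure {x, y}, g ^ 5 = 1 → ∃ r : GammaPlus, ∃ k < 5, g = r⁻¹ * x ^ k * r) →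
      ∃ n : GammaPlus, ∃ k < 5, g = n⁻¹ * x ^ k * n := by
    rintro x y ⟨n, hn⟩ H
    obtain ⟨r, k, hk, e⟩ := H _ hn (by rw [conj_pow, hg]; group)
    refine ⟨r * n, k, hk, ?_⟩
    have : g = n⁻¹ * (n * g * n⁻¹) * n := by group
    rw [this, e]; group
  have memx : ∀ x y : GammaPlus, x ∈ Subgroup.closure {x, y} := fun x y =>
    Subgroup.subset_closure (by simp)
  have memy : ∀ x y : GammaPlus, y ∈ Subgroup.closure {x, y} := fun x y =>
    Subgroup.subset_closure (by simp)
  have ss1 : ss 1 = inl gC * TT := rfl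
  have ss2 : ss 2 = inl gA * TT := rfl
  have ss3 : ss 3 = inl gB * TT := rfl
  fin_cases j
  · -- vertex 0
    have hp := parab 3 0 {gB * gA, gC * gB} (by decide) (by
        intro i hi
        fin_cases i
        · exact absurd rfl hi
        · refine ⟨gC * gB, memy _ _, ?_⟩
          change ss 1 = _ * ss 3
          rw [ss1, ss3, ← mul_assoc, ← map_mul, mul_assoc, ← sq gB, relB, mul_one]
        · refine ⟨(gB * gA)⁻¹, inv_mem (memx _ _), ?_⟩
          change ss 2 = _ * ss 3
          rw [ss2, ss3, ← mul_assoc, ← map_mul, mul_inv_rev, inv_mul_cancel_right, invA]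
        · exact ⟨1, one_mem _, by simp⟩) (by
        rintro x (rfl | rfl)
        · refine ⟨(gB * gA)⁻¹, inv_mem (memx _ _), ?_⟩
          rw [ss3, mul_assoc, TT_inl, map_mul sigmaHom, sigmaHom_A, sigmaHom_B, ← mul_assoc,
            ← map_mul, ← mul_assoc, ← mul_assoc, ← map_mul, mul_inv_rev, inv_mul_cancel_right,
            ← sq gB, relB, one_mul, invA]
        · refine ⟨(gC * gB)⁻¹, inv_mem (memy _ _), ?_⟩
          rw [ss3, mul_assoc, TT_inl, map_mul sigmaHom, sigmaHom_C, sigmaHom_B, ← mul_assoc,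
            ← map_mul, ← mul_assoc, ← mul_assoc, ← map_mul, mul_inv_rev, invB]) g w hw
    obtain ⟨n, k, hk, e⟩ := fin _ _ hp (a5_conj relBA relCB (by
      have : gB * gA * (gC * gB) = gB * gA * (gC * gA) * (gB * gA)⁻¹ := by
        rw [mul_inv_rev, invB]; simp [mul_assoc]
      rw [this, conj_pow, relCA]; group))
    refine ⟨gA * n, k, hk, Or.inr ?_⟩
    rw [e]
    have : gB * gA = gA⁻¹ * (gA * gB) * (gA⁻¹)⁻¹ := by group
    rw [this, conj_pow]; group
  · have hp := parab 0 1 {gA * gB, gA} (by decide) (by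
        intro i hi
        fin_cases i
        · exact ⟨1, one_mem _, by simp⟩
        · exact absurd rfl hi
        · refine ⟨gA, memy _ _, ?_⟩
          rw [ss_zero]; rfl
        · refine ⟨gB, ?_, ?_⟩
          · have := mul_mem (inv_mem (memy (gA * gB) gA)) (memx (gA * gB) gA)
            rwa [inv_mul_cancel_left] at this
          · rw [ss_zero]; rfl) (by
        rintro x (rfl | rfl)
        · exact ⟨gA * gB, memx _ _, by
            rw [ss_zero, TT_inl, map_mul sigmaHom, sigmaHom_A, sigmaHom_B]⟩
        · exact ⟨gA, memy _ _, by rw [ss_zero, TT_inl, sigmaHom_A]⟩) g w hw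
    obtain ⟨n, k, hk, e⟩ := fin _ _ hp (dihedral_conj relAB relA (by
      have : gA * gB * gA = gA * gB * gA⁻¹ := by rw [invA]
      rw [this, conj_pow, relB]; group))
    exact ⟨n, k, hk, Or.inr e⟩
  · have hp := parab 0 2 {gC, gB} (by decide) (by
        intro i hi
        fin_cases i
        · exact ⟨1, one_mem _, by simp⟩
        · refine ⟨gC, memx _ _, ?_⟩
          rw [ss_zero]; rfl
        · exact absurd rfl hi
        · refine ⟨gB, memy _ _, ?_⟩
          rw [ss_zero]; rfl) (by
        rintro x (rfl | rfl)
        · exact ⟨gC⁻¹, inv_mem (memx _ _), by rw [ss_zero, TT_inl, sigmaHom_C]⟩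
        · exact ⟨gB, memy _ _, by rw [ss_zero, TT_inl, sigmaHom_B]⟩) g w hw
    obtain ⟨n, k, hk, e⟩ := fin _ _ hp (dihedral_conj relC relB relCB)
    exact ⟨n, k, hk, Or.inl e⟩
  · have hp := parab 0 3 {gC, gA} (by decide) (by
        intro i hi
        fin_cases i
        · exact ⟨1, one_mem _, by simp⟩
        · refine ⟨gC, memx _ _, ?_⟩
          rw [ss_zero]; rfl
        · refine ⟨gA, memy _ _, ?_⟩
          rw [ss_zero]; rfl
        · exact absurd rfl hi) (by
        rintro x (rfl | rfl)
        · exact ⟨gC⁻¹, inv_mem (memx _ _), by rw [ss_zero, TT_inl, sigmaHom_C]⟩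
        · exact ⟨gA, memy _ _, by rw [ss_zero, TT_inl, sigmaHom_A]⟩) g w hw
    obtain ⟨n, k, hk, e⟩ := fin _ _ hp (a5_conj relC relA relCA)
    exact ⟨n, k, hk, Or.inl e⟩

theorem conj_pow_cases {x y g n : GammaPlus} (hx : x ^ 5 = 1) (hy : y * x * y⁻¹ = x⁻¹) {k : ℕ}
    (hk : k < 5) (hg : g ≠ 1) (e : g = n⁻¹ * x ^ k * n) :
    ConjClasses.mk g = ConjClasses.mk x ∨ ConjClasses.mk g = ConjClasses.mk (x ^ 2) := by
  have h1 : IsConj g (x ^ k) := isConj_iff.2 ⟨n, by rw [e]; group⟩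
  have hyk : ∀ m : ℕ, IsConj ((x ^ m)⁻¹) (x ^ m) := fun m => by
    have : y * x ^ m * y⁻¹ = (x ^ m)⁻¹ := by rw [← conj_pow, hy, inv_pow]
    exact (isConj_iff.2 ⟨y, this⟩).symm
  rw [ConjClasses.mk_eq_mk_iff_isConj, ConjClasses.mk_eq_mk_iff_isConj]
  interval_cases k
  · exfalso; apply hg; rw [e]; group
  · left; simpa using h1
  · right; exact h1
  · right
    have : x ^ 3 = (x ^ 2)⁻¹ := by
      rw [eq_comm, inv_eq_iff_mul_eq_one, ← pow_add]; exact hx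
    rw [this] at h1
    exact h1.trans (hyk 2)
  · left
    have : x ^ 4 = (x ^ 1)⁻¹ := by
      rw [eq_comm, inv_eq_iff_mul_eq_one, ← pow_add]; exact hx
    rw [this] at h1
    simpa using h1.trans (hyk 1)

theorem conj_mul' : goldenConj * goldenConj = goldenConj + 1 := by
  rw [← sq, goldenConj_sq]
end Concrete

/-- The group `Γ⁺` contains exactly 4 conjugacy classes of elements of order 5. -/
theorem gammaPlus_four_classes_of_order_five :
    Nat.card {c : ConjClasses GammaPlus //
      ∃ g : GammaPlus, c = ConjClasses.mk g ∧ orderOf g = 5} = 4 := by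
  have hg1 := Real.one_lt_goldenRatio
  have hg2 := Real.goldenRatio_lt_two
  have hgc := Real.goldenConj_neg
  have gm := golden_mul
  have n12 : ¬ IsConj gC (gC ^ 2) := fun h => by
    have := tr_conj _ _ golden_mul golden_mul h
    rw [tr_C, tr_C2] at this; linarith
  have n34 : ¬ IsConj (gA * gB) ((gA * gB) ^ 2) := fun h => by
    have := tr_conj _ _ golden_mul golden_mul h
    rw [tr_AB, tr_AB2] at this; linarith
  have n13 : ¬ IsConj gC (gA * gB) := fun h => by
    have := tr_conj _ _ golden_mul conj_mul' h
    rw [tr_C, tr_AB] at this; linarith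
  have n14 : ¬ IsConj gC ((gA * gB) ^ 2) := fun h => by
    have := tr_conj _ _ golden_mul golden_mul h
    rw [tr_C, tr_AB2] at this; linarith
  have n23 : ¬ IsConj (gC ^ 2) (gA * gB) := fun h => by
    have := tr_conj _ _ golden_mul golden_mul h
    rw [tr_C2, tr_AB] at this; linarith
  have n24 : ¬ IsConj (gC ^ 2) ((gA * gB) ^ 2) := fun h => by
    have := tr_conj _ _ golden_mul conj_mul' h
    rw [tr_C2, tr_AB2] at this; linarith
  have ne1 : gC ≠ 1 := fun h => by
    have := tr_C _ _ golden_mul golden_mul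
    rw [h, tr_one] at this; linarith
  have ne2 : gC ^ 2 ≠ 1 := fun h => by
    have := tr_C2 _ _ golden_mul golden_mul
    rw [h, tr_one] at this; linarith
  have ne3 : gA * gB ≠ 1 := fun h => by
    have := tr_AB _ _ golden_mul golden_mul
    rw [h, tr_one] at this; linarith
  have ne4 : (gA * gB) ^ 2 ≠ 1 := fun h => by
    have := tr_AB2 _ _ golden_mul golden_mul
    rw [h, tr_one] at this; linarith
  have hset : {c : ConjClasses GammaPlus | ∃ g : GammaPlus, c = ConjClasses.mk g ∧ orderOf g = 5} =
      {ConjClasses.mk gC, ConjClasses.mk (gC ^ 2), ConjClasses.mk (gA * gB),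
        ConjClasses.mk ((gA * gB) ^ 2)} := by
    have : Fact (Nat.Prime 5) := ⟨by norm_num⟩
    ext x
    simp only [Set.mem_ofPred_eq, Set.mem_insert_iff, Set.mem_singleton_iff]
    constructor
    · rintro ⟨g, rfl, hg⟩
      have g5 : g ^ 5 = 1 := by rw [← hg]; exact pow_orderOf_eq_one g
      have gne : g ≠ 1 := by rintro rfl; simp at hg
      obtain ⟨n, k, hk, e | e⟩ := torsion_five g g5
      · rcases conj_pow_cases relC invC hk gne e with h | h <;> simp [h]
      · rcases conj_pow_cases relAB invAB hk gne e with h | h <;> simp [h]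
    · rintro (rfl | rfl | rfl | rfl)
      · exact ⟨_, rfl, orderOf_eq_prime relC ne1⟩
      · exact ⟨_, rfl, orderOf_eq_prime (by rw [← pow_mul, mul_comm, pow_mul, relC, one_pow]) ne2⟩
      · exact ⟨_, rfl, orderOf_eq_prime relAB ne3⟩
      · exact ⟨_, rfl, orderOf_eq_prime (by rw [← pow_mul, mul_comm, pow_mul, relAB, one_pow]) ne4⟩
  have hcard : {c : ConjClasses GammaPlus |
      ∃ g : GammaPlus, c = ConjClasses.mk g ∧ orderOf g = 5}.ncard = 4 := by
    rw [hset, Set.ncard_insert_of_notMem, Set.ncard_insert_of_notMem, Set.ncard_pair]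
    · rw [Ne, ConjClasses.mk_eq_mk_iff_isConj]; exact n34
    · simp only [Set.mem_insert_iff, Set.mem_singleton_iff, ConjClasses.mk_eq_mk_iff_isConj]
      tauto
    · simp only [Set.mem_insert_iff, Set.mem_singleton_iff, ConjClasses.mk_eq_mk_iff_isConj]
      tauto
  exact hcard
end
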